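/- arXiv:1102.0270 — 3 statements merged into one kernel-verified Lean document; each statement's English description precedes it below -/
import Mathlib

section
/- The number C(n) of unlabeled rooted trees with n nodes satisfies, for n > 1, the recursion C(n) = (1/(n−1)) · Σ_{k=1}^{n−1} C(n−k) · Σ_{m | k} m·C(m), with C(1) = 1, where the inner sum is over positive divisors m of k. -/
/-- A rooted tree on the nodes `0, …, n-1`, rooted at `0`, encoded by its parent
function in increasing form: the root is its own parent, and every other node's
parent has a smaller label. -/
def IsTreeParent (n : ℕ) (p : Fin n → Fin n) : Prop :=
  ∀ i : Fin n, (i.val = 0 → p i = i) ∧ (i.val ≠ 0 → (p i).val < i.val)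

def RootedTreeP (n : ℕ) := {p : Fin n → Fin n // IsTreeParent n p}

/-- Isomorphism of rooted trees: a relabeling of the nodes intertwining the
parent functions (such a relabeling automatically fixes the root). -/
def treeIso {n : ℕ} (p q : RootedTreeP n) : Prop :=
  ∃ σ : Fin n ≃ Fin n, ∀ i, σ (p.1 i) = q.1 (σ i)

/-- `C(n)`, the number of unlabeled rooted trees with `n` nodes: the number of
isomorphism classes of rooted trees on `n` nodes. -/
noncomputable def numUnlabeledRootedTreePs (n : ℕ) : ℕ :=
  Nat.card (Quot (@treeIso n))


namespace OtterTree

/-- Node constructor on codes: a code is a pair (size, label). -/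
def node (M : Multiset (ℕ × ℕ)) : ℕ × ℕ :=
  (1 + (M.map Prod.fst).sum, Encodable.encode M)

theorem node_inj {M N : Multiset (ℕ × ℕ)} (h : node M = node N) : M = N :=
  Encodable.encode_injective (Prod.ext_iff.1 h).2

inductive Good : ℕ × ℕ → Prop
  | mk (M : Multiset (ℕ × ℕ)) (h : ∀ y ∈ M, Good y) : Good (node M)

theorem good_iff (x : ℕ × ℕ) : Good x ↔ ∃ M : Multiset (ℕ × ℕ), (∀ y ∈ M, Good y) ∧ node M = x := by
  constructor
  · rintro ⟨M, h⟩; exact ⟨M, h, rfl⟩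
  · rintro ⟨M, h, rfl⟩; exact ⟨M, h⟩

theorem Good.pos {x : ℕ × ℕ} (h : Good x) : 1 ≤ x.1 := by
  rcases h with ⟨M, h⟩; simp [node]

/-- Abstract counting of weighted multisets. -/
theorem count_multisets (A : ℕ → Finset (Multiset (ℕ × ℕ))) (G : ℕ → Finset (ℕ × ℕ))
    (P : ℕ × ℕ → Prop) (hP : ∀ x, P x → 1 ≤ x.1)
    (hA : ∀ N M, M ∈ A N ↔ (∀ y ∈ M, P y) ∧ (M.map Prod.fst).sum = N)
    (hG : ∀ m x, x ∈ G m ↔ P x ∧ x.1 = m) (N : ℕ) :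
    N * (A N).card = ∑ k ∈ Finset.Icc 1 N, (A (N - k)).card *
      ∑ m ∈ k.divisors, m * (G m).card := by
  classical
  have hle : ∀ M ∈ A N, ∀ y ∈ M, Multiset.count y M * y.1 ≤ N := by
    intro M hM y hy
    obtain ⟨h1, h2⟩ := (hA _ _).1 hM
    rw [← h2, Finset.sum_multiset_map_count]
    simpa using Finset.single_le_sum (f := fun z => Multiset.count z M * z.1)
      (fun _ _ => Nat.zero_le _) (Multiset.mem_toFinset.2 hy)
  have h1 : ∀ M ∈ A N, N = ∑ m ∈ Finset.Icc 1 N, ∑ y ∈ G m, Multiset.count y M * m := by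
    intro M hM
    obtain ⟨h1, h2⟩ := (hA _ _).1 hM
    have : ∀ m ∈ Finset.Icc 1 N, ∑ y ∈ G m, Multiset.count y M * m
        = ∑ y ∈ M.toFinset with y.1 = m, Multiset.count y M * y.1 := by
      intro m _
      symm
      rw [Finset.sum_congr rfl (g := fun y => Multiset.count y M * m)]
      · apply Finset.sum_subset
        · intro y hy
          simp only [Finset.mem_filter, Multiset.mem_toFinset] at hy
          exact (hG _ _).2 ⟨h1 _ hy.1, hy.2⟩
        · intro y hy hy'
          simp only [Finset.mem_filter, Multiset.mem_toFinset, not_and] at hy'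
          have : y ∉ M := fun h => hy' h ((hG _ _).1 hy).2
          simp [Multiset.count_eq_zero.2 this]
      · intro y hy
        rw [(Finset.mem_filter.1 hy).2]
    rw [Finset.sum_congr rfl this, Finset.sum_fiberwise_of_maps_to]
    · conv_lhs => rw [← h2, Finset.sum_multiset_map_count]
      simp
    · intro y hy
      have hy := Multiset.mem_toFinset.1 hy
      have h3 := hle M hM y hy
      have h4 := Multiset.one_le_count_iff_mem.2 hy
      have := hP _ (h1 _ hy)
      simp only [Finset.mem_Icc]
      exact ⟨this, by nlinarith⟩
  have h2 : ∀ m ∈ Finset.Icc 1 N, ∀ y ∈ G m, ∀ M ∈ A N, Multiset.count y M * m =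
      ∑ k ∈ Finset.Icc 1 N, if m ∣ k ∧ Multiset.replicate (k / m) y ≤ M then m else 0 := by
    intro m hm y hy M hM
    have hm1 := (Finset.mem_Icc.1 hm).1
    have hc : Multiset.count y M * m ≤ N := by
      by_cases hyM : y ∈ M
      · have := hle M hM y hyM
        rwa [((hG _ _).1 hy).2] at this
      · simp [Multiset.count_eq_zero.2 hyM]
    rw [← Finset.sum_filter, Finset.sum_const, smul_eq_mul]
    congr 1
    have himg : (Finset.Icc 1 N).filter (fun k => m ∣ k ∧ Multiset.replicate (k / m) y ≤ M)
        = (Finset.Icc 1 (Multiset.count y M)).image (fun j => j * m) := by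
      ext k
      simp only [Finset.mem_filter, Finset.mem_Icc, Finset.mem_image,
        ← Multiset.le_count_iff_replicate_le]
      constructor
      · rintro ⟨⟨hk1, hk2⟩, hd, hr⟩
        refine ⟨k / m, ⟨?_, hr⟩, Nat.div_mul_cancel hd⟩
        exact Nat.div_pos (Nat.le_of_dvd hk1 hd) hm1
      · rintro ⟨j, ⟨hj1, hj2⟩, rfl⟩
        rw [Nat.mul_div_cancel _ hm1]
        refine ⟨⟨Nat.mul_pos hj1 hm1, ?_⟩, Nat.dvd_mul_left _ _, hj2⟩
        exact (Nat.mul_le_mul_right m hj2).trans hc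
    rw [himg, Finset.card_image_of_injective, Nat.card_Icc]
    · omega
    · intro i j hij
      exact Nat.eq_of_mul_eq_mul_right hm1 hij
  have h3 : ∀ k ∈ Finset.Icc 1 N, ∀ m ∈ k.divisors, ∀ y ∈ G m,
      ((A N).filter (fun M => Multiset.replicate (k / m) y ≤ M)).card = (A (N - k)).card := by
    intro k hk m hm y hy
    have hdvd := Nat.dvd_of_mem_divisors hm
    obtain ⟨hy1, hy2⟩ := (hG _ _).1 hy
    have hkN := (Finset.mem_Icc.1 hk).2
    have hkm : k / m * m = k := Nat.div_mul_cancel hdvd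
    symm
    apply Finset.card_bij' (fun M _ => M + Multiset.replicate (k / m) y)
      (fun M _ => M - Multiset.replicate (k / m) y)
    · intro M hM
      obtain ⟨h4, h5⟩ := (hA _ _).1 hM
      simp only [Finset.mem_filter, hA, Multiset.mem_add]
      refine ⟨⟨?_, ?_⟩, Multiset.le_add_left _ _⟩
      · rintro z (hz | hz)
        · exact h4 z hz
        · rw [Multiset.eq_of_mem_replicate hz]; exact hy1
      · simp [h5, hy2, hkm]; omega
    · intro M hM
      simp only [Finset.mem_filter, hA] at hM
      obtain ⟨⟨h4, h5⟩, h6⟩ := hM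
      obtain ⟨M', rfl⟩ := Multiset.le_iff_exists_add.1 h6
      rw [add_tsub_cancel_left]
      refine (hA _ _).2 ⟨fun z hz => h4 z (Multiset.mem_add.2 (Or.inr hz)), ?_⟩
      simp [hy2, hkm] at h5; omega
    · intro M hM
      simp
    · intro M hM
      exact tsub_add_cancel_of_le (Finset.mem_filter.1 hM).2
  calc N * (A N).card = ∑ M ∈ A N, N := by simp [mul_comm]
    _ = ∑ M ∈ A N, ∑ m ∈ Finset.Icc 1 N, ∑ y ∈ G m, ∑ k ∈ Finset.Icc 1 N,
          if m ∣ k ∧ Multiset.replicate (k / m) y ≤ M then m else 0 := by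
        refine Finset.sum_congr rfl fun M hM => (h1 M hM).trans ?_
        exact Finset.sum_congr rfl fun m hm => Finset.sum_congr rfl fun y hy => h2 m hm y hy M hM
    _ = ∑ k ∈ Finset.Icc 1 N, ∑ m ∈ Finset.Icc 1 N, ∑ y ∈ G m, ∑ M ∈ A N, 
          if m ∣ k ∧ Multiset.replicate (k / m) y ≤ M then m else 0 := by
        rw [Finset.sum_comm]
        rw [Finset.sum_comm (s := Finset.Icc 1 N) (t := Finset.Icc 1 N)]
        refine Finset.sum_congr rfl fun m hm => ?_
        rw [Finset.sum_comm, Finset.sum_comm (s := Finset.Icc 1 N)]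
        refine Finset.sum_congr rfl fun y hy => ?_
        rw [Finset.sum_comm]
    _ = _ := by
        refine Finset.sum_congr rfl fun k hk => ?_
        have hk' := Finset.mem_Icc.1 hk
        rw [Finset.mul_sum]
        symm
        have hsub : k.divisors ⊆ Finset.Icc 1 N := by
          intro m hm
          have := Nat.divisor_le hm
          have := Nat.pos_of_mem_divisors hm
          simp; omega
        rw [Finset.sum_congr rfl (g := fun m => ∑ y ∈ G m, ∑ M ∈ A N, 
          if m ∣ k ∧ Multiset.replicate (k / m) y ≤ M then m else 0)]
        · apply Finset.sum_subset hsub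
          intro m _ hm
          have : ¬ m ∣ k := fun h => hm (Nat.mem_divisors.2 ⟨h, by omega⟩)
          simp [this]
        · intro m hm
          have hdvd := Nat.dvd_of_mem_divisors hm
          rw [Finset.sum_congr rfl (g := fun y => (A (N - k)).card * m)]
          · simp; ring
          · intro y hy
            simp only [hdvd, true_and]
            rw [← Finset.sum_filter, Finset.sum_const, h3 k hk m hm y hy, smul_eq_mul]

/-- The children of `i` in the tree on `0, …, n-1` with parent function `f`. -/
def children (n : ℕ) (f : ℕ → ℕ) (i : ℕ) : Finset ℕ :=
  (Finset.range n).filter (fun j => i < j ∧ f j = i)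

theorem mem_children {n : ℕ} {f : ℕ → ℕ} {i j : ℕ} :
    j ∈ children n f i ↔ j < n ∧ i < j ∧ f j = i := by
  simp [children]

/-- The code of the subtree at `i`. -/
def code (n : ℕ) (f : ℕ → ℕ) (i : ℕ) : ℕ × ℕ :=
  node ((children n f i).attach.val.map (fun j => code n f j.1))
termination_by n - i
decreasing_by
  have := mem_children.1 j.2
  omega

theorem code_eq (n : ℕ) (f : ℕ → ℕ) (i : ℕ) :
    code n f i = node ((children n f i).val.map (code n f)) := by
  rw [code]
  congr 1
  exact Multiset.attach_map_val' (children n f i).val (code n f)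

theorem code_good (n : ℕ) (f : ℕ → ℕ) (i : ℕ) : Good (code n f i) := by
  induction h : n - i using Nat.strong_induction_on generalizing i with
  | _ d ih =>
    rw [code_eq]
    refine Good.mk _ fun y hy => ?_
    obtain ⟨j, hj, rfl⟩ := Multiset.mem_map.1 hy
    have := mem_children.1 hj
    exact ih (n - j) (by omega) j rfl

/-- Uniqueness of codes. -/
theorem code_unique (n : ℕ) (f : ℕ → ℕ) (c : ℕ → ℕ × ℕ)
    (hc : ∀ i < n, c i = node ((children n f i).val.map c)) (i : ℕ) (hi : i < n) :
    code n f i = c i := by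
  induction h : n - i using Nat.strong_induction_on generalizing i with
  | _ d ih =>
    rw [code_eq, hc i hi]
    congr 1
    refine Multiset.map_congr rfl fun j hj => ?_
    have := mem_children.1 hj
    exact ih (n - j) (by omega) j (by omega) rfl

def IsT (n : ℕ) (f : ℕ → ℕ) : Prop := ∀ i, 0 < i → i < n → f i < i

theorem code_size (n : ℕ) (f : ℕ → ℕ) (hf : IsT n f) (hn : 0 < n) : (code n f 0).1 = n := by
  have h1 : ∀ i, (code n f i).1 = 1 + ∑ j ∈ children n f i, (code n f j).1 := by
    intro i
    conv_lhs => rw [code_eq]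
    simp [node]
  have h2 : ∑ i ∈ Finset.range n, (code n f i).1
      = n + ∑ j ∈ (Finset.range n).filter (fun j => 0 < j), (code n f j).1 := by
    rw [Finset.sum_congr rfl fun i _ => h1 i, Finset.sum_add_distrib]
    congr 1
    · simp
    · rw [← Finset.sum_fiberwise_of_maps_to (s := (Finset.range n).filter (fun j => 0 < j))
        (t := Finset.range n) (g := f)]
      · refine Finset.sum_congr rfl fun i hi => Finset.sum_congr ?_ fun _ _ => rfl
        ext j
        simp only [mem_children, Finset.mem_filter, Finset.mem_range]
        constructor
        · rintro ⟨a, b, c⟩; exact ⟨⟨a, by omega⟩, c⟩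
        · rintro ⟨⟨a, b⟩, c⟩; exact ⟨a, c ▸ hf j b a, c⟩
      · intro j hj
        simp only [Finset.mem_filter, Finset.mem_range] at hj ⊢
        have := hf j hj.2 hj.1
        omega
  have h3 : (Finset.range n).filter (fun j => 0 < j) = (Finset.range n).erase 0 := by
    ext j; simp; omega
  rw [h3, ← Finset.add_sum_erase _ _ (Finset.mem_range.2 hn)] at h2
  omega

/-- Every good code is realized. -/
theorem code_surj (x : ℕ × ℕ) (hx : Good x) : ∃ n f, 0 < n ∧ IsT n f ∧ code n f 0 = x := by
  induction hx with
  | mk M h ih =>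
    clear h
    induction M using Multiset.induction with
    | empty =>
      refine ⟨1, fun _ => 0, one_pos, fun i hi _ => hi, ?_⟩
      rw [code_eq]
      congr 1
    | cons y M ihM =>
      obtain ⟨a, s, ha, hs, hsc⟩ := ihM fun z hz => ih z (Multiset.mem_cons_of_mem hz)
      obtain ⟨b, t, hb, ht, htc⟩ := ih y (Multiset.mem_cons_self _ _)
      let f : ℕ → ℕ := fun i => if i < a then s i else if i = a then 0 else a + t (i - a)
      let c : ℕ → ℕ × ℕ := fun i => if i = 0 then node (y ::ₘ M) else
        if i < a then code a s i else code b t (i - a)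
      have hsM := hsc
      rw [code_eq] at hsM
      have hsM := node_inj hsM
      refine ⟨a + b, f, by omega, ?_, ?_⟩
      · intro i hi hi'
        simp only [f]
        split_ifs with h1 h2
        · exact hs i hi h1
        · exact hi
        · have := ht (i - a) (by omega) (by omega)
          omega
      · rw [code_unique (a + b) f c _ 0 (by omega)]
        · simp [c]
        intro i hi
        have hcs : ∀ j ∈ (children a s i).val, c j = code a s j := by
          intro j hj
          have := mem_children.1 hj
          simp only [c]
          rw [if_neg (by omega), if_pos this.1]
        by_cases h0 : i = 0
        · subst h0
          have hch : children (a + b) f 0 = insert a (children a s 0) := by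
            ext j
            simp only [mem_children, Finset.mem_insert, f]
            split_ifs with h1 h2 <;> omega
          have hni : a ∉ children a s 0 := by simp [mem_children]
          rw [hch, Finset.insert_val_of_notMem hni, Multiset.map_cons,
            Multiset.map_congr rfl hcs, hsM]
          have : c a = y := by
            simp only [c]
            rw [if_neg (by omega), if_neg (by omega), Nat.sub_self, htc]
          rw [this]
          simp [c]
        · by_cases h1 : i < a
          · have hch : children (a + b) f i = children a s i := by
              ext j
              simp only [mem_children, f]
              split_ifs with h2 h3 <;> omega
            rw [hch, Multiset.map_congr rfl hcs, ← code_eq]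
            simp [c, h0, h1]
          · have hch : children (a + b) f i = (children b t (i - a)).map (addLeftEmbedding a) := by
              ext j
              simp only [mem_children, f, Finset.mem_map, addLeftEmbedding_apply]
              constructor
              · rintro ⟨h2, h3, h4⟩
                rw [if_neg (by omega), if_neg (by omega)] at h4
                exact ⟨j - a, by omega, by omega⟩
              · rintro ⟨j, ⟨h2, h3, h4⟩, rfl⟩
                rw [if_neg (by omega), if_neg (by omega), Nat.add_sub_cancel_left]
                omega
            rw [hch, Finset.map_val, Multiset.map_map]
            have : c i = code b t (i - a) := by simp [c, h0, h1]
            rw [this, code_eq]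
            congr 1
            refine Multiset.map_congr rfl fun j hj => ?_
            have := mem_children.1 hj
            simp only [Function.comp, addLeftEmbedding_apply, c]
            rw [if_neg (by omega), if_neg (by omega), Nat.add_sub_cancel_left]

theorem exists_match {α β γ : Type*} [DecidableEq α] [DecidableEq β] (f : α → γ) (g : β → γ)
    (s : Finset α) (t : Finset β) [Nonempty β] (h : s.val.map f = t.val.map g) :
    ∃ e : α → β, (∀ x ∈ s, e x ∈ t ∧ g (e x) = f x) ∧ Set.InjOn e s := by
  induction s using Finset.induction generalizing t with
  | empty => exact ⟨fun _ => Classical.arbitrary β, by simp, by simp⟩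
  | insert a s ha ih =>
    rw [Finset.insert_val_of_notMem ha, Multiset.map_cons] at h
    have : f a ∈ t.val.map g := h ▸ Multiset.mem_cons_self _ _
    obtain ⟨b, hb, hba⟩ := Multiset.mem_map.1 this
    have hb : b ∈ t := hb
    have ht := Finset.insert_erase hb
    rw [← ht, Finset.insert_val_of_notMem (Finset.notMem_erase _ _), Multiset.map_cons, hba] at h
    obtain ⟨e, he, hinj⟩ := ih _ ((Multiset.cons_inj_right _).1 h)
    refine ⟨Function.update e a b, ?_, ?_⟩
    · intro x hx
      by_cases hxa : x = a
      · subst hxa; simp [hb, hba]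
      · have := he x (Finset.mem_of_mem_insert_of_ne hx hxa)
        rw [Function.update_of_ne hxa]
        exact ⟨Finset.mem_of_mem_erase this.1, this.2⟩
    · have hb' : ∀ x ∈ s, e x ≠ b := fun x hx => Finset.ne_of_mem_erase (he x hx).1
      intro x hx y hy hxy
      have hx := Finset.mem_insert.1 hx
      have hy := Finset.mem_insert.1 hy
      by_cases hxa : x = a <;> by_cases hya : y = a
      · rw [hxa, hya]
      · rw [hxa, Function.update_self, Function.update_of_ne hya] at hxy
        exact absurd hxy.symm (hb' y (hy.resolve_left hya))
      · rw [hya, Function.update_self, Function.update_of_ne hxa] at hxy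
        exact absurd hxy (hb' x (hx.resolve_left hxa))
      · rw [Function.update_of_ne hya, Function.update_of_ne hxa] at hxy
        exact hinj (hx.resolve_left hxa) (hy.resolve_left hya) hxy

/-- Equal codes give an isomorphism. -/
theorem code_inj (n : ℕ) (f g : ℕ → ℕ) (hf : IsT n f) (hn : 0 < n)
    (h : code n f 0 = code n g 0) :
    ∃ σ : ℕ → ℕ, σ 0 = 0 ∧ (∀ i < n, σ i < n) ∧ (∀ i < n, ∀ j < n, σ i = σ j → i = j) ∧
      ∀ i, 0 < i → i < n → 0 < σ i ∧ σ (f i) = g (σ i) := by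
  have hex : ∀ v w, ∃ e : ℕ → ℕ, code n f v = code n g w →
      (∀ x ∈ children n f v, e x ∈ children n g w ∧ code n g (e x) = code n f x) ∧
        Set.InjOn e (children n f v) := by
    intro v w
    by_cases hvw : code n f v = code n g w
    · rw [code_eq, code_eq] at hvw
      obtain ⟨e, he⟩ := exists_match _ _ _ _ (node_inj hvw)
      exact ⟨e, fun _ => he⟩
    · exact ⟨id, fun h => absurd h hvw⟩
  choose e he using hex
  have hσ : ∃ σ : ℕ → ℕ, σ 0 = 0 ∧ ∀ i, 0 < i → i < n → σ i = e (f i) (σ (f i)) i := by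
    let F : (i : ℕ) → ((j : ℕ) → j < i → ℕ) → ℕ := fun i r =>
      if hi : f i < i then e (f i) (r (f i) hi) i else 0
    have hF : ∀ i, Nat.lt_wfRel.wf.fix F i = F i (fun j _ => Nat.lt_wfRel.wf.fix F j) :=
      fun i => WellFounded.fix_eq _ _ _
    refine ⟨Nat.lt_wfRel.wf.fix F, ?_, ?_⟩
    · rw [hF]; simp [F]
    · intro i hi hin
      rw [hF]
      simp [F, hf i hi hin]
  obtain ⟨σ, h0, hσ⟩ := hσ
  have hch : ∀ i, 0 < i → i < n → i ∈ children n f (f i) := fun i hi hin =>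
    mem_children.2 ⟨hin, hf i hi hin, rfl⟩
  have hcode : ∀ i < n, code n f i = code n g (σ i) := by
    intro i
    induction i using Nat.strong_induction_on with
    | _ i ih =>
      intro hin
      rcases Nat.eq_zero_or_pos i with rfl | hi
      · rw [h0, h]
      · have hlt := hf i hi hin
        have := ih (f i) hlt (by omega)
        rw [hσ i hi hin]
        exact (((he _ _ this).1 i (hch i hi hin)).2).symm
  have hmem : ∀ i, 0 < i → i < n → σ i ∈ children n g (σ (f i)) := by
    intro i hi hin
    have hlt := hf i hi hin
    rw [hσ i hi hin]
    exact ((he _ _ (hcode (f i) (by omega))).1 i (hch i hi hin)).1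
  refine ⟨σ, h0, ?_, ?_, ?_⟩
  · intro i hin
    rcases Nat.eq_zero_or_pos i with rfl | hi
    · omega
    · exact (mem_children.1 (hmem i hi hin)).1
  · intro i
    induction i using Nat.strong_induction_on with
    | _ i ih =>
      intro hin j hjn hij
      rcases Nat.eq_zero_or_pos i with rfl | hi <;> rcases Nat.eq_zero_or_pos j with rfl | hj
      · rfl
      · have := mem_children.1 (hmem j hj hjn); omega
      · have := mem_children.1 (hmem i hi hin); omega
      · have h1 := mem_children.1 (hmem j hj hjn)
        have h2 := mem_children.1 (hmem i hi hin)
        have hlt := hf i hi hin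
        have hlt' := hf j hj hjn
        have hff : f i = f j := ih (f i) hlt (by omega) (f j) (by omega) (by
          rw [← h1.2.2, ← h2.2.2, hij])
        rw [hσ i hi hin, hσ j hj hjn, ← hff] at hij
        refine (he _ _ (hcode (f i) (by omega))).2 (hch i hi hin) ?_ hij
        rw [hff]
        exact hch j hj hjn
  · intro i hi hin
    have := mem_children.1 (hmem i hi hin)
    exact ⟨by omega, this.2.2.symm⟩

/-- Isomorphic trees have equal codes. -/
theorem code_iso (n : ℕ) (f g : ℕ → ℕ) (hf : IsT n f) (hg : IsT n g) (σ : Equiv.Perm ℕ)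
    (h0 : σ 0 = 0) (hσn : ∀ i, σ i < n ↔ i < n) 
    (hσ : ∀ i, 0 < i → i < n → σ (f i) = g (σ i)) (i : ℕ) :
    code n f i = code n g (σ i) := by
  induction h : n - i using Nat.strong_induction_on generalizing i with
  | _ d ih =>
    rw [code_eq, code_eq]
    congr 1
    have hpos : ∀ j, 0 < σ j ↔ 0 < j := by
      intro j
      rw [Nat.pos_iff_ne_zero, Nat.pos_iff_ne_zero, not_iff_not]
      exact ⟨fun h => σ.injective (h.trans h0.symm), fun h => h ▸ h0⟩
    have hch : children n g (σ i) = (children n f i).map σ.toEmbedding := by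
      ext j
      obtain ⟨j, rfl⟩ := σ.surjective j
      have hm : σ j ∈ (children n f i).map σ.toEmbedding ↔ j ∈ children n f i :=
        Finset.mem_map' σ.toEmbedding
      rw [hm, mem_children, mem_children, hσn]
      refine and_congr_right fun hjn => ?_
      constructor
      · rintro ⟨h1, h2⟩
        have hj : 0 < j := (hpos j).1 (by omega)
        have : f j = i := σ.injective (by rw [hσ j hj hjn, h2])
        exact ⟨this ▸ hf j hj hjn, this⟩
      · rintro ⟨h1, h2⟩
        have hj : 0 < j := by omega
        have h3 := hσ j hj hjn
        rw [h2] at h3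
        have := hg (σ j) ((hpos j).2 hj) ((hσn j).2 hjn)
        omega
    rw [hch, Finset.map_val, Multiset.map_map]
    refine Multiset.map_congr rfl fun j hj => ?_
    have := mem_children.1 hj
    exact ih (n - j) (by omega) j rfl

/-- Extension of a parent function to `ℕ`. -/
def ext {n : ℕ} (p : RootedTreeP n) (i : ℕ) : ℕ := if h : i < n then (p.1 ⟨i, h⟩).1 else 0

theorem ext_val {n : ℕ} (p : RootedTreeP n) (i : Fin n) : ext p i.1 = (p.1 i).1 := by
  simp [ext]

theorem ext_isT {n : ℕ} (p : RootedTreeP n) : IsT n (ext p) := by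
  intro i hi hin
  have := (p.2 ⟨i, hin⟩).2 (by simp; omega)
  simpa [ext, hin] using this

theorem iso_iff {n : ℕ} (hn : 0 < n) (p q : RootedTreeP n) :
    treeIso p q ↔ code n (ext p) 0 = code n (ext q) 0 := by
  constructor
  · rintro ⟨σ, hσ⟩
    let τ : Equiv.Perm ℕ := Equiv.Perm.extendDomain (p := fun i => i < n) σ Fin.equivSubtype
    have hτ : ∀ i : Fin n, τ i.1 = (σ i).1 := fun i =>
      Equiv.Perm.extendDomain_apply_image σ Fin.equivSubtype i
    have hτ' : ∀ i, ¬ i < n → τ i = i := fun i hi =>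
      Equiv.Perm.extendDomain_apply_not_subtype σ Fin.equivSubtype hi
    have h0 : τ 0 = 0 := by
      have h1 := hσ ⟨0, hn⟩
      rw [(p.2 ⟨0, hn⟩).1 rfl] at h1
      have h2 := hτ ⟨0, hn⟩
      rw [show τ 0 = _ from h2]
      by_contra h3
      have := (q.2 _).2 h3
      rw [← h1] at this
      omega
    rw [code_iso n (ext p) (ext q) (ext_isT p) (ext_isT q) τ h0 ?_ ?_ 0, h0]
    · intro i
      by_cases hi : i < n
      · have := hτ ⟨i, hi⟩
        simp only at this
        simp [hi, this]
      · rw [hτ' i hi]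
    · intro i _ hi
      have h1 := hτ ⟨i, hi⟩
      simp only at h1
      rw [h1, ext_val, ← hσ, ← hτ, ← ext_val]
  · intro h
    obtain ⟨σ, h0, h1, h2, h3⟩ := code_inj n _ _ (ext_isT p) hn h
    let s : Fin n → Fin n := fun i => ⟨σ i.1, h1 i.1 i.2⟩
    have hs : Function.Injective s := fun i j hij =>
      Fin.ext (h2 _ i.2 _ j.2 (Fin.ext_iff.1 hij))
    refine ⟨Equiv.ofBijective s (Finite.injective_iff_bijective.1 hs), fun i => ?_⟩
    simp only [Equiv.ofBijective_apply]
    rcases Nat.eq_zero_or_pos i.1 with hi | hi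
    · rw [(p.2 i).1 hi]
      have : (s i).1 = 0 := by simp [s, hi, h0]
      rw [(q.2 _).1 this]
    · have := (h3 i.1 hi i.2).2
      apply Fin.ext
      rw [← ext_val q]
      simp only [s]
      rw [← ext_val p, this]

theorem bij {n : ℕ} (hn : 0 < n) : ∃ F : Quot (@treeIso n) → {x : ℕ × ℕ // Good x ∧ x.1 = n},
    Function.Bijective F := by
  refine ⟨Quot.lift (fun p => ⟨code n (ext p) 0, code_good _ _ _, code_size n _ (ext_isT p) hn⟩)
    fun p q h => Subtype.ext ((iso_iff hn p q).1 h), ?_, ?_⟩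
  · rintro ⟨p⟩ ⟨q⟩ h
    exact Quot.sound ((iso_iff hn p q).2 (Subtype.ext_iff.1 h))
  · rintro ⟨x, hx, hxn⟩
    obtain ⟨m, f, hm, hf, hc⟩ := code_surj x hx
    have : m = n := by rw [← hxn, ← hc, code_size m f hf hm]
    subst this
    have hlt : ∀ i : Fin m, (if i.1 = 0 then 0 else f i.1) < m := by
      intro i
      split_ifs with h
      · exact hm
      · have := hf i.1 (by omega) i.2
        omega
    let p : RootedTreeP m := ⟨fun i => ⟨if i.1 = 0 then 0 else f i.1, hlt i⟩, by
      intro i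
      constructor
      · intro h; apply Fin.ext; simp [h]
      · intro h; simp only [h, if_false]; exact hf i.1 (by omega) i.2⟩
    refine ⟨Quot.mk _ p, Subtype.ext ?_⟩
    change code m (ext p) 0 = x
    rw [← hc]
    apply code_unique m (ext p) (code m f) _ 0 hm
    intro i hi
    rw [code_eq]
    have : children m f i = children m (ext p) i := by
      ext j
      simp only [mem_children]
      refine and_congr_right fun hj => and_congr_right fun hij => ?_
      have : ext p j = f j := by
        rw [show ext p j = _ from ext_val p ⟨j, hj⟩]
        simp only [p]
        rw [if_neg (by omega)]
      rw [this]
    rw [this]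

theorem num_eq {n : ℕ} (hn : 0 < n) :
    numUnlabeledRootedTreePs n = {x : ℕ × ℕ | Good x ∧ x.1 = n}.ncard := by
  obtain ⟨F, hF⟩ := bij hn
  rw [numUnlabeledRootedTreePs, Nat.card_eq_of_bijective F hF]
  rfl

theorem level_finite (n : ℕ) : {x : ℕ × ℕ | Good x ∧ x.1 = n}.Finite := by
  rcases Nat.eq_zero_or_pos n with rfl | hn
  · convert Set.finite_empty
    ext x
    simp only [Set.mem_ofPred_eq, Set.mem_empty_iff_false, iff_false, not_and]
    rintro ⟨M, h⟩
    simp [node]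
  · obtain ⟨F, hF⟩ := bij hn
    have : Finite (RootedTreeP n) := Subtype.finite
    have : Finite (Quot (@treeIso n)) := Quot.finite _
    have h1 := Finite.of_surjective F hF.2
    exact Set.finite_coe_iff.1 h1

theorem recursion_aux (N : ℕ) :
    N * numUnlabeledRootedTreePs (N + 1) = ∑ k ∈ Finset.Icc 1 N,
      numUnlabeledRootedTreePs (N - k + 1) *
        ∑ m ∈ k.divisors, m * numUnlabeledRootedTreePs m := by
  classical
  let S : ℕ → Set (Multiset (ℕ × ℕ)) := fun N =>
    {M | (∀ y ∈ M, Good y) ∧ (M.map Prod.fst).sum = N}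
  have himg : ∀ N, Set.image node (S N) = {x : ℕ × ℕ | Good x ∧ x.1 = N + 1} := by
    intro N
    ext x
    constructor
    · rintro ⟨M, ⟨h1, h2⟩, rfl⟩
      exact ⟨Good.mk M h1, by simp [node, h2, add_comm]⟩
    · rintro ⟨hx, hx1⟩
      obtain ⟨M, h1, rfl⟩ := (good_iff x).1 hx
      refine ⟨M, ⟨h1, ?_⟩, rfl⟩
      simp only [node] at hx1
      omega
  have hinj : ∀ N, Set.InjOn node (S N) := fun N _ _ _ _ h => node_inj h
  have hfin : ∀ N, (S N).Finite := by
    intro N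
    apply Set.Finite.of_finite_image _ (hinj N)
    rw [himg]
    exact level_finite _
  have hcard : ∀ N, (hfin N).toFinset.card = numUnlabeledRootedTreePs (N + 1) := by
    intro N
    rw [num_eq (Nat.succ_pos N), ← himg, (hinj N).ncard_image,
      Set.ncard_eq_toFinset_card _ (hfin N)]
  have key := count_multisets (fun N => (hfin N).toFinset) (fun m => (level_finite m).toFinset)
    Good (fun x hx => hx.pos) (fun N M => by simp [S]) (fun m x => by simp) N
  simp only [hcard] at key
  rw [key]
  refine Finset.sum_congr rfl fun k _ => ?_
  congr 1
  refine Finset.sum_congr rfl fun m hm => ?_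
  rw [num_eq (Nat.pos_of_mem_divisors hm), Set.ncard_eq_toFinset_card _ (level_finite m)]

theorem num_one : numUnlabeledRootedTreePs 1 = 1 := by
  rw [numUnlabeledRootedTreePs, Nat.card_eq_one_iff_unique]
  constructor
  · constructor
    rintro ⟨p⟩ ⟨q⟩
    congr 1
    exact Subtype.ext (Subsingleton.elim _ _)
  · exact ⟨Quot.mk _ ⟨id, fun i => ⟨fun _ => rfl, fun h => absurd (by omega) h⟩⟩⟩

end OtterTree

/-- The Cayley–Otter recursion for unlabeled rooted trees:
`C(1) = 1` and `(n−1)·C(n) = Σ_{k=1}^{n−1} C(n−k) · Σ_{m ∣ k} m·C(m)` for `n > 1`. -/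
theorem unlabeled_rooted_tree_recursion :
    numUnlabeledRootedTreePs 1 = 1 ∧
    ∀ n : ℕ, 1 < n →
      (n - 1) * numUnlabeledRootedTreePs n =
        ∑ k ∈ Finset.Icc 1 (n - 1), numUnlabeledRootedTreePs (n - k) *
          ∑ m ∈ k.divisors, m * numUnlabeledRootedTreePs m := by
  refine ⟨OtterTree.num_one, fun n hn => ?_⟩
  obtain ⟨N, rfl⟩ : ∃ N, n = N + 1 := ⟨n - 1, by omega⟩
  rw [Nat.add_sub_cancel, OtterTree.recursion_aux]
  refine Finset.sum_congr rfl fun k hk => ?_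
  have := (Finset.mem_Icc.1 hk).2
  rw [show N + 1 - k = N - k + 1 by omega]
end

section
/- In the braid group B_n with n ≥ 3, the full twist Δ² (the square of the Garside half-twist element, equal to (σ₁σ₂⋯σ_{n−1})ⁿ) generates the center of B_n. -/
/-- The braid relations on generators `σ_0, …, σ_{m-1}` (as elements of the free
group): `σ_i σ_{i+1} σ_i = σ_{i+1} σ_i σ_{i+1}` and `σ_i σ_j = σ_j σ_i` for
`|i − j| ≥ 2`. -/
def braidRels (m : ℕ) : Set (FreeGroup (Fin m)) :=
  {r | (∃ i j : Fin m, i.val + 1 = j.val ∧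
          r = FreeGroup.of i * FreeGroup.of j * FreeGroup.of i *
              (FreeGroup.of j * FreeGroup.of i * FreeGroup.of j)⁻¹) ∨
       (∃ i j : Fin m, i.val + 2 ≤ j.val ∧
          r = FreeGroup.of i * FreeGroup.of j * (FreeGroup.of j * FreeGroup.of i)⁻¹)}

/-- The Artin braid group `B_n` on `n` strands, presented by the generators
`σ_1, …, σ_{n-1}` and the braid relations. -/
def BraidGroup (n : ℕ) := PresentedGroup (braidRels (n - 1))

instance (n : ℕ) : Group (BraidGroup n) := by unfold BraidGroup; infer_instance

/-- The full twist `Δ² = (σ_1 σ_2 ⋯ σ_{n−1})^n` in `B_n`. -/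
def fullTwist (n : ℕ) : BraidGroup n :=
  ((List.ofFn fun i : Fin (n - 1) =>
      (PresentedGroup.of (rels := braidRels (n - 1)) i : BraidGroup n)).prod) ^ n


namespace BraidCenter

/-! ### The positive (Artin) monoid of a simply laced triangle-free graph -/

section Graph

variable {I : Type} (adj : I → I → Prop)

/-- Defining relations of the positive monoid. -/
inductive PRel : FreeMonoid I → FreeMonoid I → Prop
  | braid (i j : I) : adj i j →
      PRel (FreeMonoid.of i * (FreeMonoid.of j * FreeMonoid.of i))
        (FreeMonoid.of j * (FreeMonoid.of i * FreeMonoid.of j))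
  | far (i j : I) : i ≠ j → ¬ adj i j →
      PRel (FreeMonoid.of i * FreeMonoid.of j) (FreeMonoid.of j * FreeMonoid.of i)

/-- The positive monoid. -/
abbrev PM := PresentedMonoid (PRel adj)

/-- Generators. -/
def gen (i : I) : PM adj := PresentedMonoid.of (PRel adj) i

/-- The length homomorphism. -/
def lenHom : PM adj →* Multiplicative ℕ :=
  PresentedMonoid.lift (fun _ => Multiplicative.ofAdd 1) (by
    intro a b h
    cases h <;> simp)

/-- The length. -/
def len (x : PM adj) : ℕ := Multiplicative.toAdd (lenHom adj x)

@[simp] lemma len_one : len adj 1 = 0 := by simp [len]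
@[simp] lemma len_mul (x y : PM adj) : len adj (x * y) = len adj x + len adj y := by simp [len]
@[simp] lemma len_gen (i : I) : len adj (gen adj i) = 1 := rfl
@[simp] lemma len_pow (x : PM adj) (k : ℕ) : len adj (x ^ k) = k * len adj x := by simp [len]

lemma gen_braid {i j : I} (h : adj i j) (x : PM adj) :
    gen adj i * (gen adj j * (gen adj i * x)) = gen adj j * (gen adj i * (gen adj j * x)) := by
  have := PresentedMonoid.mk_eq_mk_of_rel (PRel.braid i j h)
  simp only [map_mul] at this
  have h2 := congrArg (· * x) this
  simpa [mul_assoc, gen, PresentedMonoid.of] using h2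

lemma gen_far {i j : I} (hne : i ≠ j) (h : ¬ adj i j) (x : PM adj) :
    gen adj i * (gen adj j * x) = gen adj j * (gen adj i * x) := by
  have := PresentedMonoid.mk_eq_mk_of_rel (PRel.far (adj := adj) i j hne h)
  simp only [map_mul] at this
  have h2 := congrArg (· * x) this
  simpa [mul_assoc, gen, PresentedMonoid.of] using h2

lemma exists_gen_mul (x : PM adj) : x = 1 ∨ ∃ i y, x = gen adj i * y := by
  obtain ⟨w, rfl⟩ := PresentedMonoid.surjective_mk x
  induction w using FreeMonoid.inductionOn' with
  | one => left; simp
  | of_mul i w _ => right; exact ⟨i, PresentedMonoid.mk _ w, by simp [gen, PresentedMonoid.of]⟩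

lemma pm_induction {p : PM adj → Prop} (h1 : p 1) (hm : ∀ i y, p y → p (gen adj i * y))
    (x : PM adj) : p x := by
  obtain ⟨w, rfl⟩ := PresentedMonoid.surjective_mk x
  induction w using FreeMonoid.inductionOn' with
  | one => simpa using h1
  | of_mul i w ih => rw [map_mul]; exact hm _ _ ih

/-- The conclusion of Garside's lemma. -/
def Good (i j : I) (a b : PM adj) : Prop :=
  (i = j ∧ a = b) ∨
  (i ≠ j ∧ ¬ adj i j ∧ ∃ c, a = gen adj j * c ∧ b = gen adj i * c) ∨
  (i ≠ j ∧ adj i j ∧ ∃ c, a = gen adj j * (gen adj i * c) ∧ b = gen adj i * (gen adj j * c))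

variable {adj}

lemma Good.symm (hs : ∀ i j, adj i j → adj j i) {i j : I} {a b : PM adj} (h : Good adj i j a b) :
    Good adj j i b a := by
  rcases h with ⟨rfl, rfl⟩ | ⟨h1, h2, c, rfl, rfl⟩ | ⟨h1, h2, c, rfl, rfl⟩
  · exact Or.inl ⟨rfl, rfl⟩
  · exact Or.inr (Or.inl ⟨h1.symm, fun h => h2 (hs _ _ h), c, rfl, rfl⟩)
  · exact Or.inr (Or.inr ⟨h1.symm, hs _ _ h2, c, rfl, rfl⟩)

lemma Good.mul {i j : I} {a b : PM adj} (h : Good adj i j a b) (z : PM adj) :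
    Good adj i j (a * z) (b * z) := by
  rcases h with ⟨rfl, rfl⟩ | ⟨h1, h2, c, rfl, rfl⟩ | ⟨h1, h2, c, rfl, rfl⟩
  · exact Or.inl ⟨rfl, rfl⟩
  · exact Or.inr (Or.inl ⟨h1, h2, c * z, by simp [mul_assoc], by simp [mul_assoc]⟩)
  · exact Or.inr (Or.inr ⟨h1, h2, c * z, by simp [mul_assoc], by simp [mul_assoc]⟩)

/-- Garside's lemma for tails of length `< l`. -/
def HH (adj : I → I → Prop) (l : ℕ) : Prop :=
  ∀ (i j : I) (a b : PM adj), len adj a < l → gen adj i * a = gen adj j * b → Good adj i j a b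

lemma HH.cancel {l : ℕ} (H : HH adj l) {i : I} {a b : PM adj} (hl : len adj a < l)
    (h : gen adj i * a = gen adj i * b) : a = b := by
  rcases H i i a b hl h with ⟨_, h⟩ | ⟨h, _⟩ | ⟨h, _⟩
  · exact h
  · exact absurd rfl h
  · exact absurd rfl h

lemma HH.far {l : ℕ} (H : HH adj l) {i j : I} (hne : i ≠ j) (ha : ¬ adj i j) {a b : PM adj}
    (hl : len adj a < l) (h : gen adj i * a = gen adj j * b) :
    ∃ c, a = gen adj j * c ∧ b = gen adj i * c := by
  rcases H i j a b hl h with ⟨h, _⟩ | ⟨_, _, h⟩ | ⟨_, h, _⟩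
  · exact absurd h hne
  · exact h
  · exact absurd h ha

lemma HH.nbr {l : ℕ} (H : HH adj l) {i j : I} (hne : i ≠ j) (ha : adj i j) {a b : PM adj}
    (hl : len adj a < l) (h : gen adj i * a = gen adj j * b) :
    ∃ c, a = gen adj j * (gen adj i * c) ∧ b = gen adj i * (gen adj j * c) := by
  rcases H i j a b hl h with ⟨h, _⟩ | ⟨_, h, _⟩ | ⟨_, _, h⟩
  · exact absurd h hne
  · exact absurd ha h
  · exact h

/-- Transitivity: the cube condition. -/
lemma Good.trans (hs : ∀ i j, adj i j → adj j i)
    (ht : ∀ i j k, adj i j → adj j k → adj i k → False)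
    {l : ℕ} (H : HH adj l) {i k j : I} {a c b : PM adj} (hl : len adj c ≤ l)
    (h1 : Good adj i k a c) (h2 : Good adj k j c b) : Good adj i j a b := by
  rcases h1 with ⟨rfl, rfl⟩ | ⟨n1, r1, x, rfl, hx⟩ | ⟨n1, r1, x, rfl, hx⟩
  · exact h2
  · -- i, k far
    rcases h2 with ⟨rfl, rfl⟩ | ⟨n2, r2, y, hy, rfl⟩ | ⟨n2, r2, y, hy, rfl⟩
    · exact Or.inr (Or.inl ⟨n1, r1, x, rfl, hx⟩)
    · -- k, j far
      have e := hx.symm.trans hy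
      have lx : len adj x < l := by rw [hx] at hl; simp at hl; omega
      rcases H i j x y lx e with ⟨rfl, rfl⟩ | ⟨n3, r3, w, rfl, rfl⟩ | ⟨n3, r3, w, rfl, rfl⟩
      · exact Or.inl ⟨rfl, rfl⟩
      · refine Or.inr (Or.inl ⟨n3, r3, gen adj k * w, ?_, ?_⟩)
        · rw [gen_far adj n2 r2]
        · rw [gen_far adj n1 r1]
      · refine Or.inr (Or.inr ⟨n3, r3, gen adj k * w, ?_, ?_⟩)
        · rw [gen_far adj n2 r2, gen_far adj n1 r1]
        · rw [← gen_far adj n1 r1, gen_far adj n2 r2]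
    · -- k, j adjacent
      have e := hx.symm.trans hy
      have lx : len adj x < l := by rw [hx] at hl; simp at hl; omega
      have hl2 : len adj (gen adj k * y) < l := by rw [hy] at hl; simp at hl ⊢; omega
      have nij : i ≠ j := by rintro rfl; exact r1 (hs _ _ r2)
      by_cases r3 : adj i j
      · obtain ⟨z, rfl, hz⟩ := H.nbr nij r3 lx e
        -- k y = i j z, k i far
        have ly : len adj y < l := by simp at hl2; omega
        obtain ⟨w, rfl, hw⟩ := H.far n1.symm (fun h => r1 (hs _ _ h)) ly hz
        -- j z = k w, adjacent j k
        have lz : len adj z < l := by simp at lx; omega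
        obtain ⟨v, rfl, rfl⟩ := H.nbr n2.symm (hs _ _ r2) lz hw
        have n1' := n1.symm
        have r1' : ¬ adj k i := fun h => r1 (hs _ _ h)
        refine Or.inr (Or.inr ⟨nij, r3, gen adj k * (gen adj j * (gen adj i * v)), ?_, ?_⟩)
        · rw [gen_far adj n1 r1, gen_braid adj r2, gen_braid adj (hs _ _ r3), gen_far adj n1' r1']
        · rw [gen_braid adj (hs _ _ r3), gen_far adj n1' r1', gen_far adj n1 r1 v, gen_braid adj r2]
      · obtain ⟨z, rfl, hz⟩ := H.far nij r3 lx e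
        have ly : len adj y < l := by simp at hl2; omega
        obtain ⟨w, rfl, rfl⟩ := H.far n1.symm (fun h => r1 (hs _ _ h)) ly hz
        refine Or.inr (Or.inl ⟨nij, r3, gen adj k * (gen adj j * w), ?_, ?_⟩)
        · rw [gen_braid adj r2]
        · rw [← gen_far adj nij r3, ← gen_far adj n1 r1]
  · -- i, k adjacent
    rcases h2 with ⟨rfl, rfl⟩ | ⟨n2, r2, y, hy, rfl⟩ | ⟨n2, r2, y, hy, rfl⟩
    · exact Or.inr (Or.inr ⟨n1, r1, x, rfl, hx⟩)
    · -- k, j far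
      have e := hx.symm.trans hy
      have nij : i ≠ j := by rintro rfl; exact r2 (hs _ _ r1)
      have ly : len adj y < l := by rw [hy] at hl; simp at hl; omega
      have lx1 : len adj (gen adj k * x) < l := by rw [hx] at hl; simp at hl ⊢; omega
      have lx : len adj x < l := by simp at lx1; omega
      have n2' := n2.symm
      have r2' : ¬ adj j k := fun h => r2 (hs _ _ h)
      by_cases r3 : adj i j
      · obtain ⟨z, hz, rfl⟩ := H.nbr nij r3 lx1 e
        obtain ⟨w, rfl, hw⟩ := H.far n2 r2 lx hz
        have lz : len adj z < l := by simp at ly; omega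
        obtain ⟨v, rfl, rfl⟩ := H.nbr n1 r1 lz hw
        refine Or.inr (Or.inr ⟨nij, r3, gen adj k * (gen adj i * (gen adj j * v)), ?_, ?_⟩)
        · rw [gen_braid adj r3, gen_far adj n2 r2 (gen adj i * (gen adj j * (gen adj k * v))),
            gen_far adj n2' r2' v, gen_braid adj (hs _ _ r1)]
        · rw [gen_far adj n2' r2', gen_braid adj (hs _ _ r1), gen_braid adj r3,
            gen_far adj n2 r2]
      · obtain ⟨z, hz, rfl⟩ := H.far nij r3 lx1 e
        obtain ⟨w, rfl, rfl⟩ := H.far n2 r2 lx hz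
        refine Or.inr (Or.inl ⟨nij, r3, gen adj k * (gen adj i * w), ?_, ?_⟩)
        · rw [gen_far adj nij r3, gen_far adj n2 r2]
        · rw [gen_braid adj r1]
    · -- k, j adjacent
      have e := hx.symm.trans hy
      have lx1 : len adj (gen adj k * x) < l := by rw [hx] at hl; simp at hl ⊢; omega
      have lx : len adj x < l := by simp at lx1; omega
      have ly1 : len adj (gen adj k * y) < l := by rw [hy] at hl; simp at hl ⊢; omega
      have ly : len adj y < l := by simp at ly1; omega
      by_cases nij : i = j
      · subst nij
        have := H.cancel lx (H.cancel lx1 e)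
        exact Or.inl ⟨rfl, by rw [this]⟩
      · have r3 : ¬ adj i j := fun h => ht _ _ _ r1 r2 h
        obtain ⟨z, hz, hz'⟩ := H.far nij r3 lx1 e
        obtain ⟨w, rfl, rfl⟩ := H.nbr n2 r2 lx hz
        obtain ⟨w', rfl, hw'⟩ := H.nbr n1.symm (hs _ _ r1) ly hz'
        have lw : len adj (gen adj j * w) < l := by simp at lx ⊢; omega
        have lw2 : len adj w < l := by simp at lw; omega
        have e2 := H.cancel lw hw'
        obtain ⟨v, rfl, rfl⟩ := H.far (Ne.symm nij) (fun h => r3 (hs _ _ h)) lw2 e2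
        have r3' : ¬ adj j i := fun h => r3 (hs _ _ h)
        refine Or.inr (Or.inl ⟨nij, r3, gen adj k * (gen adj i * (gen adj j * (gen adj k * v))),
          ?_, ?_⟩)
        · rw [gen_far adj nij r3 (gen adj k * (gen adj i * v)), gen_braid adj r1, gen_braid adj r2,
            gen_far adj (Ne.symm nij) r3']
        · rw [gen_far adj (Ne.symm nij) r3', gen_braid adj (hs _ _ r2), gen_braid adj (hs _ _ r1)]

/-- The word-level relation used in the induction. -/
def WRel (adj : I → I → Prop) (u v : FreeMonoid I) : Prop :=
  (u = 1 ∧ v = 1) ∨ ∃ i j a b, u = FreeMonoid.of i * a ∧ v = FreeMonoid.of j * b ∧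
    Good adj i j (PresentedMonoid.mk _ a) (PresentedMonoid.mk _ b)

lemma ofmul_inj {i j : I} {a b : FreeMonoid I}
    (h : FreeMonoid.of i * a = FreeMonoid.of j * b) : i = j ∧ a = b := by
  have : i :: a.toList = j :: b.toList := congrArg FreeMonoid.toList h
  have h2 := List.cons.inj this
  exact ⟨h2.1, h2.2⟩

lemma ofmul_ne_one {i : I} {a : FreeMonoid I} (h : FreeMonoid.of i * a = 1) : False := by
  have : i :: a.toList = [] := congrArg FreeMonoid.toList h
  exact List.cons_ne_nil _ _ this

lemma WRel.symm (hs : ∀ i j, adj i j → adj j i) {u v : FreeMonoid I} (h : WRel adj u v) :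
    WRel adj v u := by
  rcases h with ⟨h1, h2⟩ | ⟨i, j, a, b, h1, h2, h3⟩
  · exact Or.inl ⟨h2, h1⟩
  · exact Or.inr ⟨j, i, b, a, h2, h1, h3.symm hs⟩

lemma wrel_of_conGen (hs : ∀ i j, adj i j → adj j i) (hi : ∀ i, ¬ adj i i)
    (ht : ∀ i j k, adj i j → adj j k → adj i k → False)
    {l : ℕ} (H : HH adj l) {u v : FreeMonoid I} (h : ConGen.Rel (PRel adj) u v) :
    len adj (PresentedMonoid.mk _ u) ≤ l + 1 → WRel adj u v := by
  have key : ∀ {u v : FreeMonoid I}, ConGen.Rel (PRel adj) u v →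
      PresentedMonoid.mk (PRel adj) u = PresentedMonoid.mk _ v := fun h =>
    PresentedMonoid.mk_eq_mk_iff.2 h
  induction h with
  | of x y h =>
    intro _
    cases h with
    | braid i j h =>
      refine Or.inr ⟨_, _, _, _, rfl, rfl, Or.inr (Or.inr ⟨?_, h, 1, ?_, ?_⟩)⟩
      · rintro rfl; exact hi _ h
      · simp [gen, PresentedMonoid.of]
      · simp [gen, PresentedMonoid.of]
    | far i j hne h =>
      refine Or.inr ⟨_, _, _, _, rfl, rfl, Or.inr (Or.inl ⟨hne, h, 1, ?_, ?_⟩)⟩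
      · simp [gen, PresentedMonoid.of]
      · simp [gen, PresentedMonoid.of]
  | refl x =>
    intro _
    induction x using FreeMonoid.inductionOn' with
    | one => exact Or.inl ⟨rfl, rfl⟩
    | of_mul i w _ => exact Or.inr ⟨_, _, _, _, rfl, rfl, Or.inl ⟨rfl, rfl⟩⟩
  | symm h ih =>
    intro hl
    exact (ih (by rw [key h]; exact hl)).symm hs
  | trans h1 h2 ih1 ih2 =>
    intro hl
    have g1 := ih1 hl
    have hl2 := hl
    rw [key h1] at hl2
    have g2 := ih2 hl2
    rcases g1 with ⟨rfl, rfl⟩ | ⟨i, j, a, b, rfl, rfl, g⟩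
    · exact g2
    · rcases g2 with ⟨h, _⟩ | ⟨i', j', a', b', e, rfl, g'⟩
      · exact (ofmul_ne_one h).elim
      · obtain ⟨rfl, rfl⟩ := ofmul_inj e
        refine Or.inr ⟨_, _, _, _, rfl, rfl, Good.trans hs ht H ?_ g g'⟩
        rw [map_mul, len_mul] at hl2
        have : len adj (PresentedMonoid.mk (PRel adj) (FreeMonoid.of j)) = 1 := rfl
        omega
  | mul h1 h2 ih1 ih2 =>
    intro hl
    rw [map_mul, len_mul] at hl
    rcases ih1 (by omega) with ⟨rfl, rfl⟩ | ⟨i, j, a, b, rfl, rfl, g⟩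
    · simpa using ih2 (by omega)
    · refine Or.inr ⟨i, j, _, _, mul_assoc _ _ _, mul_assoc _ _ _, ?_⟩
      rw [map_mul, map_mul, ← key h2]
      exact g.mul _

theorem garside (hs : ∀ i j, adj i j → adj j i) (hi : ∀ i, ¬ adj i i)
    (ht : ∀ i j k, adj i j → adj j k → adj i k → False) (l : ℕ) : HH adj l := by
  induction l with
  | zero => intro i j a b h; omega
  | succ l ih =>
    intro i j a b hl e
    obtain ⟨a, rfl⟩ := PresentedMonoid.surjective_mk a
    obtain ⟨b, rfl⟩ := PresentedMonoid.surjective_mk b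
    have e' : PresentedMonoid.mk (PRel adj) (FreeMonoid.of i * a) =
      PresentedMonoid.mk (PRel adj) (FreeMonoid.of j * b) := by
      simpa [gen, PresentedMonoid.of] using e
    have := wrel_of_conGen hs hi ht ih (PresentedMonoid.mk_eq_mk_iff.1 e') (by
      rw [map_mul, len_mul]
      have : len adj (PresentedMonoid.mk (PRel adj) (FreeMonoid.of i)) = 1 := rfl
      omega)
    rcases this with ⟨h, _⟩ | ⟨i', j', a', b', e1, e2, g⟩
    · exact (ofmul_ne_one h).elim
    · obtain ⟨rfl, rfl⟩ := ofmul_inj e1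
      obtain ⟨rfl, rfl⟩ := ofmul_inj e2
      exact g

end Graph

/-! ### Identities for the half twist in a monoid -/

section Delta

variable {M : Type} [Monoid M] (s : ℕ → M)

/-- `s 0 * s 1 * ⋯ * s (k-1)`. -/
def PP : ℕ → M
  | 0 => 1
  | k + 1 => PP k * s k

/-- `s (k-1) * ⋯ * s 0`. -/
def QQ : ℕ → M
  | 0 => 1
  | k + 1 => s k * QQ k

/-- The half twist on the first `k` generators. -/
def DD : ℕ → M
  | 0 => 1
  | k + 1 => DD k * QQ s (k + 1)

/-- `s k * s (k-1) * ⋯ ` with `j` factors. -/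
def RR (k : ℕ) : ℕ → M
  | 0 => 1
  | j + 1 => RR k j * s (k - j)

variable {s} {m : ℕ}

lemma comm_PP
    (hf : ∀ i j, i + 2 ≤ j → j < m → s i * s j = s j * s i)
    (k j : ℕ) (h : k + 1 ≤ j) (hj : j < m) : Commute (s j) (PP s k) := by
  induction k with
  | zero => exact Commute.one_right _
  | succ k ih => exact (ih (by omega)).mul_right (hf k j (by omega) hj).symm

lemma comm_QQ
    (hf : ∀ i j, i + 2 ≤ j → j < m → s i * s j = s j * s i)
    (k j : ℕ) (h : k + 1 ≤ j) (hj : j < m) : Commute (s j) (QQ s k) := by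
  induction k with
  | zero => exact Commute.one_right _
  | succ k ih => exact Commute.mul_right (hf k j (by omega) hj).symm (ih (by omega))

lemma comm_DD
    (hf : ∀ i j, i + 2 ≤ j → j < m → s i * s j = s j * s i)
    (k j : ℕ) (h : k + 1 ≤ j) (hj : j < m) : Commute (s j) (DD s k) := by
  induction k with
  | zero => exact Commute.one_right _
  | succ k ih => exact (ih (by omega)).mul_right (comm_QQ hf _ _ (by omega) hj)

lemma PP_shift
    (hb : ∀ i, i + 1 < m → s i * s (i + 1) * s i = s (i + 1) * s i * s (i + 1))
    (hf : ∀ i j, i + 2 ≤ j → j < m → s i * s j = s j * s i)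
    (k j : ℕ) (hj : j + 1 < k) (hk : k ≤ m) :
    PP s k * s j = s (j + 1) * PP s k := by
  induction k with
  | zero => omega
  | succ k ih =>
    rcases Nat.lt_or_ge (j + 1) k with h | h
    · simp only [PP]
      rw [mul_assoc, ← hf j k (by omega) (by omega), ← mul_assoc, ih h (by omega), mul_assoc]
    · obtain rfl : k = j + 1 := by omega
      simp only [PP]
      have c := (comm_PP hf j (j + 1) le_rfl (by omega)).eq
      calc PP s j * s j * s (j + 1) * s j = PP s j * (s j * s (j + 1) * s j) := by
            simp only [mul_assoc]
        _ = (PP s j * s (j + 1)) * s j * s (j + 1) := by rw [hb j (by omega)]; simp only [mul_assoc]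
        _ = _ := by rw [← c]; simp only [mul_assoc]

lemma QQ_shift
    (hb : ∀ i, i + 1 < m → s i * s (i + 1) * s i = s (i + 1) * s i * s (i + 1))
    (hf : ∀ i j, i + 2 ≤ j → j < m → s i * s j = s j * s i)
    (k j : ℕ) (hj : j + 1 < k) (hk : k ≤ m) :
    s j * QQ s k = QQ s k * s (j + 1) := by
  induction k with
  | zero => omega
  | succ k ih =>
    rcases Nat.lt_or_ge (j + 1) k with h | h
    · simp only [QQ]
      rw [← mul_assoc, hf j k (by omega) (by omega), mul_assoc, ih h (by omega), mul_assoc]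
    · obtain rfl : k = j + 1 := by omega
      simp only [QQ]
      have c := (comm_QQ hf j (j + 1) le_rfl (by omega)).eq
      calc s j * (s (j + 1) * (s j * QQ s j)) = (s j * s (j + 1) * s j) * QQ s j := by
            simp only [mul_assoc]
        _ = s (j + 1) * s j * (s (j + 1) * QQ s j) := by rw [hb j (by omega)]; simp only [mul_assoc]
        _ = _ := by rw [c]; simp only [mul_assoc]

lemma DD_succ
    (hf : ∀ i j, i + 2 ≤ j → j < m → s i * s j = s j * s i)
    (k : ℕ) (hk : k + 1 ≤ m) : DD s (k + 1) = PP s (k + 1) * DD s k := by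
  induction k with
  | zero => simp [DD, PP, QQ]
  | succ k ih =>
    have c := (comm_DD hf k (k + 1) le_rfl (by omega)).eq
    calc DD s (k + 2) = DD s (k + 1) * QQ s (k + 2) := rfl
      _ = PP s (k + 1) * (DD s k * s (k + 1)) * QQ s (k + 1) := by
        rw [ih (by omega)]; simp only [QQ, mul_assoc]
      _ = PP s (k + 2) * DD s (k + 1) := by
        rw [← c]; simp only [PP, DD, mul_assoc]

lemma DD_quasi
    (hb : ∀ i, i + 1 < m → s i * s (i + 1) * s i = s (i + 1) * s i * s (i + 1))
    (hf : ∀ i j, i + 2 ≤ j → j < m → s i * s j = s j * s i)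
    (k i : ℕ) (hi : i < k) (hk : k ≤ m) :
    s i * DD s k = DD s k * s (k - 1 - i) := by
  induction k generalizing i with
  | zero => omega
  | succ k ih =>
    rcases i with _ | i
    · rcases k with _ | k
      · simp [DD, QQ]
      · have h1 := ih 0 (by omega) (by omega)
        have h2 := QQ_shift hb hf (k + 2) k (by omega) hk
        simp only [Nat.add_sub_cancel, Nat.sub_zero] at h1 ⊢
        rw [show DD s (k + 1 + 1) = DD s (k + 1) * QQ s (k + 2) from rfl, ← mul_assoc, h1,
          mul_assoc, h2, mul_assoc]
    · rw [DD_succ hf k hk, ← mul_assoc, ← PP_shift hb hf (k + 1) i (by omega) hk, mul_assoc,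
        ih i (by omega) (by omega), ← mul_assoc]
      congr 2
      omega

lemma PP_pow
    (hb : ∀ i, i + 1 < m → s i * s (i + 1) * s i = s (i + 1) * s i * s (i + 1))
    (hf : ∀ i j, i + 2 ≤ j → j < m → s i * s j = s j * s i)
    (k j : ℕ) (hj : j ≤ k + 1) (hk : k + 1 ≤ m) :
    PP s (k + 1) ^ j = PP s k ^ j * RR s k j := by
  have hR : ∀ j, j ≤ k → RR s k j * PP s (k + 1) = PP s k * RR s k (j + 1) := by
    intro j hj
    induction j with
    | zero => simp [RR, PP]
    | succ j ih =>
      have := PP_shift hb hf (k + 1) (k - (j + 1)) (by omega) hk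
      rw [show k - (j + 1) + 1 = k - j by omega] at this
      calc RR s k (j + 1) * PP s (k + 1) = RR s k j * (s (k - j) * PP s (k + 1)) := by
            simp only [RR, mul_assoc]
        _ = (RR s k j * PP s (k + 1)) * s (k - (j + 1)) := by rw [← this, mul_assoc]
        _ = _ := by rw [ih (by omega), mul_assoc]; rfl
  induction j with
  | zero => simp [RR]
  | succ j ih =>
    rw [pow_succ, ih (by omega), mul_assoc, hR j (by omega), ← mul_assoc, ← pow_succ]

lemma RR_eq (k j : ℕ) (hj : j ≤ k + 1) : RR s k j * QQ s (k + 1 - j) = QQ s (k + 1) := by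
  induction j with
  | zero => simp [RR]
  | succ j ih =>
    rw [← ih (by omega), show k + 1 - j = (k - j) + 1 by omega,
      show k + 1 - (j + 1) = k - j by omega]
    simp only [RR, QQ, mul_assoc]

/-- Everything commuting with `s 0, …, s (k-1)` commutes with `DD s k`. -/
lemma comm_DD_of (x : M) (k : ℕ) (h : ∀ j < k, Commute x (s j)) : Commute x (DD s k) := by
  have hQ : ∀ k, (∀ j < k, Commute x (s j)) → Commute x (QQ s k) := by
    intro k
    induction k with
    | zero => intro _; exact Commute.one_right _
    | succ k ih => intro h; exact (h k (by omega)).mul_right (ih fun j hj => h j (by omega))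
  induction k with
  | zero => exact Commute.one_right _
  | succ k ih => exact (ih fun j hj => h j (by omega)).mul_right (hQ _ h)

lemma DD_sq
    (hb : ∀ i, i + 1 < m → s i * s (i + 1) * s i = s (i + 1) * s i * s (i + 1))
    (hf : ∀ i j, i + 2 ≤ j → j < m → s i * s j = s j * s i)
    (k : ℕ) (hk : k ≤ m) : DD s k * DD s k = PP s k ^ (k + 1) := by
  induction k with
  | zero => simp [DD, PP]
  | succ k ih =>
    have c : Commute (QQ s (k + 1) * PP s (k + 1)) (DD s k) := by
      apply comm_DD_of
      intro j hj
      show _ = _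
      rw [mul_assoc, PP_shift hb hf (k + 1) j (by omega) hk, ← mul_assoc, ← QQ_shift hb hf (k + 1) j
        (by omega) hk, mul_assoc]
    have hR : RR s k (k + 1) = QQ s (k + 1) := by
      have := RR_eq (s := s) k (k + 1) le_rfl
      simpa [QQ] using this
    calc DD s (k + 1) * DD s (k + 1) = DD s k * QQ s (k + 1) * (PP s (k + 1) * DD s k) := by
          rw [← DD_succ hf k hk]; rfl
      _ = DD s k * ((QQ s (k + 1) * PP s (k + 1)) * DD s k) := by simp only [mul_assoc]
      _ = (DD s k * DD s k) * QQ s (k + 1) * PP s (k + 1) := by rw [c.eq]; simp only [mul_assoc]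
      _ = _ := by rw [ih (by omega), pow_succ _ (k + 1), PP_pow hb hf k (k + 1) le_rfl hk, hR]

lemma gen_dvd_DD
    (hb : ∀ i, i + 1 < m → s i * s (i + 1) * s i = s (i + 1) * s i * s (i + 1))
    (hf : ∀ i j, i + 2 ≤ j → j < m → s i * s j = s j * s i)
    (k i : ℕ) (hi : i < k) (hk : k ≤ m) : ∃ y, DD s k = s i * y := by
  induction k generalizing i with
  | zero => omega
  | succ k ih =>
    rcases Nat.lt_or_ge i k with h | h
    · obtain ⟨y, hy⟩ := ih i h (by omega)
      exact ⟨y * QQ s (k + 1), by rw [← mul_assoc, ← hy]; rfl⟩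
    · obtain rfl : i = k := by omega
      rcases i with _ | i
      · exact ⟨1, by simp [DD, QQ]⟩
      · obtain ⟨y, hy⟩ := ih i (by omega) (by omega)
        refine ⟨PP s (i + 2) * y, ?_⟩
        rw [DD_succ hf _ hk, hy, ← mul_assoc, PP_shift hb hf (i + 2) i (by omega) hk, mul_assoc]

lemma map_PP {N : Type} [Monoid N] (f : M →* N) (k : ℕ) : f (PP s k) = PP (fun i => f (s i)) k := by
  induction k with
  | zero => simp [PP]
  | succ k ih => simp [PP, ih]

end Delta

/-! ### The positive braid monoid -/

section Path

variable {m : ℕ}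

/-- Adjacency in the path graph. -/
def padj (i j : Fin m) : Prop := i.val + 1 = j.val ∨ j.val + 1 = i.val

lemma padj_symm (i j : Fin m) (h : padj i j) : padj j i := Or.symm h
lemma padj_irrefl (i : Fin m) : ¬ padj i i := by unfold padj; omega
lemma padj_tri (i j k : Fin m) (h1 : padj i j) (h2 : padj j k) (h3 : padj i k) : False := by
  unfold padj at *; omega

lemma gars (l : ℕ) : HH (padj (m := m)) l := garside padj_symm padj_irrefl padj_tri l

/-- The positive braid monoid. -/
abbrev BM (m : ℕ) := PM (padj (m := m))

/-- Generators indexed by natural numbers. -/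
def ss (m : ℕ) (i : ℕ) : BM m := if h : i < m then gen padj ⟨i, h⟩ else 1

lemma ss_of_lt {i : ℕ} (h : i < m) : ss m i = gen padj ⟨i, h⟩ := dif_pos h

lemma ss_braid (i : ℕ) (h : i + 1 < m) :
    ss m i * ss m (i + 1) * ss m i = ss m (i + 1) * ss m i * ss m (i + 1) := by
  rw [ss_of_lt h, ss_of_lt (by omega : i < m)]
  have := gen_braid (padj (m := m)) (i := ⟨i, by omega⟩) (j := ⟨i + 1, h⟩) (Or.inl rfl) 1
  simpa [mul_assoc] using this

lemma ss_far (i j : ℕ) (h : i + 2 ≤ j) (hj : j < m) : ss m i * ss m j = ss m j * ss m i := by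
  rw [ss_of_lt hj, ss_of_lt (by omega : i < m)]
  have := gen_far (padj (m := m)) (i := ⟨i, by omega⟩) (j := ⟨j, hj⟩)
    (by simp; omega) (by simp [padj]; omega) 1
  simpa [mul_assoc] using this

lemma cancel (x : BM m) {a b : BM m} (h : x * a = x * b) : a = b := by
  induction x using pm_induction with
  | h1 => simpa using h
  | hm i y ih =>
    rw [mul_assoc, mul_assoc] at h
    exact ih ((gars _).cancel (Nat.lt_succ_self _) h)

lemma ss_lcm_far {i j : ℕ} (h : i + 2 ≤ j) (hj : j < m) {a b : BM m}
    (e : ss m i * a = ss m j * b) : ∃ c, a = ss m j * c ∧ b = ss m i * c := by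
  rw [ss_of_lt hj, ss_of_lt (by omega : i < m)] at *
  exact (gars _).far (by simp; omega) (by simp [padj]; omega) (Nat.lt_succ_self _) e

lemma ss_lcm_adj {i : ℕ} (hj : i + 1 < m) {a b : BM m}
    (e : ss m i * a = ss m (i + 1) * b) :
    ∃ c, a = ss m (i + 1) * (ss m i * c) ∧ b = ss m i * (ss m (i + 1) * c) := by
  rw [ss_of_lt hj, ss_of_lt (by omega : i < m)] at *
  exact (gars _).nbr (by simp) (Or.inl rfl) (Nat.lt_succ_self _) e

/-- `x` is a product of generators far away from `s j`. -/
def Far (j : ℕ) (x : BM m) : Prop :=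
  ∀ y q, x * y = ss m j * q → ∃ y1, y = ss m j * y1 ∧ q = x * y1

lemma Far.one (j : ℕ) : Far j (1 : BM m) := by
  intro y q h
  exact ⟨q, by simpa using h, by simp⟩

lemma Far.mul {j : ℕ} {x y : BM m} (hx : Far j x) (hy : Far j y) : Far j (x * y) := by
  intro z q h
  rw [mul_assoc] at h
  obtain ⟨y1, h1, rfl⟩ := hx _ _ h
  obtain ⟨y2, rfl, rfl⟩ := hy _ _ h1
  exact ⟨y2, rfl, by rw [mul_assoc]⟩

lemma Far.gen {i j : ℕ} (h : i + 2 ≤ j) (hj : j < m) : Far j (ss m i) := by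
  intro y q e
  exact ss_lcm_far h hj e

lemma Far.QQ (k j : ℕ) (h : k + 1 ≤ j) (hj : j < m) : Far j (QQ (ss m) k) := by
  induction k with
  | zero => exact Far.one j
  | succ k ih => exact (Far.gen (by omega) hj).mul (ih (by omega))

lemma Far.DD (k j : ℕ) (h : k + 1 ≤ j) (hj : j < m) : Far j (DD (ss m) k) := by
  induction k with
  | zero => exact Far.one j
  | succ k ih => exact (ih (by omega)).mul (Far.QQ _ _ (by omega) hj)

lemma chain (k : ℕ) (hk : k < m) (y w : BM m) (h : QQ (ss m) k * y = ss m k * w) :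
    ∃ y', y = QQ (ss m) (k + 1) * y' := by
  induction k generalizing y w with
  | zero => exact ⟨w, by simpa [BraidCenter.QQ] using h⟩
  | succ k ih =>
    rw [BraidCenter.QQ, mul_assoc] at h
    obtain ⟨c, h1, rfl⟩ := ss_lcm_adj hk h
    obtain ⟨y1, rfl, h2⟩ := Far.QQ k (k + 1) le_rfl hk _ _ h1
    obtain ⟨y', rfl⟩ := ih (by omega) y1 c h2.symm
    exact ⟨y', by rw [← mul_assoc]; rfl⟩

lemma DD_dvd (k : ℕ) (hk : k ≤ m) (z : BM m) (h : ∀ i < k, ∃ w, z = ss m i * w) :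
    ∃ y, z = DD (ss m) k * y := by
  induction k with
  | zero => exact ⟨z, by simp [BraidCenter.DD]⟩
  | succ k ih =>
    obtain ⟨y, rfl⟩ := ih (by omega) (fun i hi => h i (by omega))
    obtain ⟨w, hw⟩ := h k (by omega)
    have : ∃ w', QQ (ss m) k * y = ss m k * w' := by
      rcases k with _ | k
      · exact ⟨w, by simpa [BraidCenter.QQ, BraidCenter.DD] using hw⟩
      · rw [BraidCenter.DD, mul_assoc] at hw
        obtain ⟨y1, h1, _⟩ := Far.DD k (k + 1) le_rfl (by omega) _ _ hw
        exact ⟨y1, h1⟩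
    obtain ⟨w', hw'⟩ := this
    obtain ⟨y', rfl⟩ := chain k (by omega) y w' hw'
    exact ⟨y', by rw [← mul_assoc]; rfl⟩

lemma dvd_adj {p : BM m} {τ : Fin m → Fin m}
    (hp : ∀ i, gen padj i * p = p * gen padj (τ i)) {i j : Fin m} (h : padj i j)
    (hi : ∃ w, p = gen padj i * w) : ∃ w, p = gen padj j * w := by
  obtain ⟨w, hw⟩ := hi
  have h1 : gen padj j * p = gen padj i * (w * gen padj (τ j)) := by
    rw [hp j, hw, mul_assoc]
  have hne : j ≠ i := by rintro rfl; exact padj_irrefl _ h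
  obtain ⟨c, hc, _⟩ := (gars _).nbr hne (padj_symm _ _ h) (Nat.lt_succ_self _) h1
  refine ⟨c * gen padj (τ i), cancel (gen padj i) ?_⟩
  rw [hp i, hc]
  simp only [mul_assoc]

lemma dvd_all {p : BM m} {τ : Fin m → Fin m}
    (hp : ∀ i, gen padj i * p = p * gen padj (τ i)) {i : Fin m}
    (hi : ∃ w, p = gen padj i * w) (j : ℕ) (hj : j < m) : ∃ w, p = ss m j * w := by
  have step : ∀ k, (hk : k < m) → ((∃ w, p = ss m k * w) ↔ ∃ w, p = ss m 0 * w) := by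
    intro k
    induction k with
    | zero => intro _; rfl
    | succ k ih =>
      intro hk
      rw [← ih (by omega), ss_of_lt hk, ss_of_lt (by omega : k < m)]
      exact ⟨dvd_adj hp (Or.inr rfl), dvd_adj hp (Or.inl rfl)⟩
  rw [step j hj, ← step i.val i.isLt, ss_of_lt i.isLt]
  exact hi

lemma gen_DD (i : Fin m) :
    gen padj i * DD (ss m) m = DD (ss m) m * gen padj i.rev := by
  have := DD_quasi ss_braid ss_far m i.val i.isLt le_rfl
  rw [ss_of_lt i.isLt, ss_of_lt (by omega : m - 1 - i.val < m)] at this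
  rw [this]
  congr 2
  ext
  simp [Fin.val_rev]
  omega

lemma len_DD_pos (hm : 0 < m) : 0 < len padj (DD (ss m) m) := by
  obtain ⟨y, hy⟩ := gen_dvd_DD (ss_braid (m := m)) ss_far m 0 hm le_rfl
  rw [hy, ss_of_lt hm]
  simp

lemma quasi (hm : 0 < m) (l : ℕ) (p : BM m) (τ : Fin m → Fin m) (hl : len padj p ≤ l)
    (hp : ∀ i, gen padj i * p = p * gen padj (τ i)) : ∃ k : ℕ, p = DD (ss m) m ^ k := by
  induction l generalizing p τ with
  | zero =>
    rcases exists_gen_mul padj p with rfl | ⟨i, y, rfl⟩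
    · exact ⟨0, by simp⟩
    · simp at hl
  | succ l ih =>
    rcases exists_gen_mul padj p with rfl | ⟨i, y, hy⟩
    · exact ⟨0, by simp⟩
    · obtain ⟨q, rfl⟩ := DD_dvd m le_rfl p (fun j hj => dvd_all hp ⟨y, hy⟩ j hj)
      obtain ⟨k, rfl⟩ := ih q (fun i => τ i.rev) (by
          have := len_DD_pos hm
          rw [len_mul] at hl
          omega) (by
        intro i
        apply cancel (DD (ss m) m)
        have h1 := hp i.rev
        rw [← mul_assoc, gen_DD, Fin.rev_rev] at h1
        rw [← mul_assoc, h1, mul_assoc])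
      exact ⟨k + 1, by rw [pow_succ']⟩

/-- The full twist in the monoid. -/
def TT (m : ℕ) : BM m := DD (ss m) m * DD (ss m) m

lemma TT_comm (x : BM m) : x * TT m = TT m * x := by
  induction x using pm_induction with
  | h1 => simp
  | hm i y ih =>
    rw [mul_assoc, ih, ← mul_assoc, ← mul_assoc]
    congr 1
    rw [TT, ← mul_assoc, gen_DD, mul_assoc, gen_DD, Fin.rev_rev, mul_assoc]

lemma TT_pow_comm (k : ℕ) (x : BM m) : x * TT m ^ k = TT m ^ k * x :=
  (Commute.pow_right (TT_comm x : Commute x (TT m)) k).eq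

/-- The Ore set of powers of the full twist. -/
noncomputable instance oreTT : OreLocalization.OreSet (Submonoid.powers (TT m)) where
  ore_right_cancel r₁ r₂ s h := by
    obtain ⟨_, k, rfl⟩ := s
    refine ⟨1, ?_⟩
    simp only [TT_pow_comm] at h
    rw [cancel _ h]
  oreNum r _ := r
  oreDenom _ s := s
  ore_eq r s := by
    obtain ⟨_, k, rfl⟩ := s
    exact (TT_pow_comm k r).symm

/-- The localization. -/
abbrev LL (m : ℕ) := OreLocalization (Submonoid.powers (TT m)) (BM m)

/-- The map to the localization. -/
noncomputable def iot (m : ℕ) : BM m →* LL m := OreLocalization.numeratorHom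

lemma iot_inj : Function.Injective (iot m) := by
  intro a b h
  simp only [iot, OreLocalization.numeratorHom_apply] at h
  rw [OreLocalization.oreDiv_eq_iff] at h
  obtain ⟨u, v, h1, h2⟩ := h
  obtain ⟨_, k, rfl⟩ := u
  simp only [Submonoid.coe_one, mul_one] at h2
  rw [← h2] at h1
  exact (cancel _ h1).symm

lemma iot_unit (i : Fin m) : IsUnit (iot m (gen padj i)) := by
  obtain ⟨y, hy⟩ := gen_dvd_DD (ss_braid (m := m)) ss_far m i.val i.isLt le_rfl
  rw [ss_of_lt i.isLt] at hy
  have h1 : gen padj i * (y * DD (ss m) m) = TT m := by rw [← mul_assoc, ← hy]; rfl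
  have h2 : (y * DD (ss m) m) * gen padj i = TT m := by
    apply cancel (gen padj i)
    rw [← mul_assoc, h1, TT_comm]
  have hT : IsUnit (iot m (TT m)) :=
    OreLocalization.numerator_isUnit (⟨TT m, Submonoid.mem_powers _⟩ : Submonoid.powers (TT m))
  obtain ⟨u, hu⟩ := hT
  rw [isUnit_iff_exists]
  have e1 : iot m (gen padj i) * iot m (y * DD (ss m) m) = u := by rw [← map_mul, h1, hu]
  have e2 : iot m (y * DD (ss m) m) * iot m (gen padj i) = u := by rw [← map_mul, h2, hu]
  exact isUnit_iff_exists.1 (isUnit_iff_exists_and_exists.2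
    ⟨⟨iot m (y * DD (ss m) m) * ↑u⁻¹, by rw [← mul_assoc, e1, Units.mul_inv]⟩,
     ⟨↑u⁻¹ * iot m (y * DD (ss m) m), by rw [mul_assoc, e2, Units.inv_mul]⟩⟩)

/-! ### The braid group -/

/-- The braid group on `m` generators. -/
abbrev BG (m : ℕ) := PresentedGroup (braidRels m)

/-- Generators of the braid group. -/
def gg (i : Fin m) : BG m := PresentedGroup.of i

lemma gg_braid (i j : Fin m) (h : i.val + 1 = j.val) : gg i * gg j * gg i = gg j * gg i * gg j := by
  have : (PresentedGroup.mk (braidRels m)) (FreeGroup.of i * FreeGroup.of j * FreeGroup.of i *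
              (FreeGroup.of j * FreeGroup.of i * FreeGroup.of j)⁻¹) = 1 :=
    (QuotientGroup.eq_one_iff _).2 (Subgroup.subset_normalClosure (Or.inl ⟨i, j, h, rfl⟩))
  rw [map_mul, map_inv, mul_inv_eq_one] at this
  simp only [map_mul] at this
  exact this

lemma gg_far (i j : Fin m) (h : i.val + 2 ≤ j.val) : gg i * gg j = gg j * gg i := by
  have : (PresentedGroup.mk (braidRels m)) (FreeGroup.of i * FreeGroup.of j *
              (FreeGroup.of j * FreeGroup.of i)⁻¹) = 1 :=
    (QuotientGroup.eq_one_iff _).2 (Subgroup.subset_normalClosure (Or.inr ⟨i, j, h, rfl⟩))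
  rw [map_mul, map_inv, mul_inv_eq_one] at this
  simp only [map_mul] at this
  exact this

/-- The map from the monoid to the group. -/
def phi (m : ℕ) : BM m →* BG m := PresentedMonoid.lift gg (by
  intro a b h
  cases h with
  | braid i j h =>
    rcases h with h | h
    · simpa [mul_assoc] using gg_braid i j h
    · simpa [mul_assoc] using (gg_braid j i h).symm
  | far i j hne h =>
    have : i.val ≠ j.val := fun h => hne (Fin.ext h)
    unfold padj at h
    rcases Nat.lt_or_ge i.val j.val with h1 | h1
    · simpa using gg_far i j (by omega)
    · simpa using (gg_far j i (by omega)).symm)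

lemma phi_gen (i : Fin m) : phi m (gen padj i) = gg i := rfl

/-- The map from the group to the units of the localization. -/
noncomputable def psi (m : ℕ) : BG m →* (LL m)ˣ :=
  PresentedGroup.toGroup (f := fun i => (iot_unit i).unit) (by
    rintro r (⟨i, j, h, rfl⟩ | ⟨i, j, h, rfl⟩)
    · rw [map_mul, map_inv, mul_inv_eq_one]
      ext
      have := gen_braid (padj (m := m)) (i := i) (j := j) (Or.inl h) 1
      simp only [mul_one, ← mul_assoc] at this
      simpa using congrArg (iot m) this
    · rw [map_mul, map_inv, mul_inv_eq_one]
      ext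
      have := gen_far (padj (m := m)) (i := i) (j := j) (by rintro rfl; omega)
        (by unfold padj; omega) 1
      simp only [mul_one] at this
      simpa using congrArg (iot m) this)

lemma psi_phi (x : BM m) : (psi m (phi m x) : LL m) = iot m x := by
  induction x using pm_induction with
  | h1 => simp
  | hm i y ih =>
    rw [map_mul, map_mul, map_mul, Units.val_mul, ih, phi_gen]
    congr 1
    simp [psi, gg]

lemma phi_inj : Function.Injective (phi m) := by
  intro a b h
  apply iot_inj
  rw [← psi_phi, ← psi_phi, h]

lemma bg_induction {p : BG m → Prop} (h1 : p 1) (hm : ∀ i y, p y → p (y * gg i))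
    (hi : ∀ i y, p y → p (y * (gg i)⁻¹)) (x : BG m) : p x := by
  have hx : x ∈ Subgroup.closure (Set.range (PresentedGroup.of (rels := braidRels m))) := by
    rw [PresentedGroup.closure_range_of]; trivial
  induction hx using Subgroup.closure_induction_right with
  | one => exact h1
  | mul_right x hx y hy ih => obtain ⟨i, rfl⟩ := hy; exact hm i x ih
  | mul_inv_cancel x hx y hy ih => obtain ⟨i, rfl⟩ := hy; exact hi i x ih

lemma phiT_central : phi m (TT m) ∈ Subgroup.center (BG m) := by
  rw [Subgroup.mem_center_iff]
  intro x
  have key : ∀ i : Fin m, gg i * phi m (TT m) = phi m (TT m) * gg i := by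
    intro i
    rw [← phi_gen, ← map_mul, ← map_mul, TT_comm]
  induction x using bg_induction with
  | h1 => simp
  | hm i y ih => rw [mul_assoc, key, ← mul_assoc, ih, mul_assoc]
  | hi i y ih =>
    have : Commute (gg i)⁻¹ (phi m (TT m)) := Commute.inv_left (key i)
    rw [mul_assoc, this.eq, ← mul_assoc, ih, mul_assoc]

lemma positive (x : BG m) : ∃ (N : ℕ) (p : BM m), phi m (TT m) ^ N * x = phi m p := by
  have hc := Subgroup.mem_center_iff.1 (phiT_central (m := m))
  induction x using bg_induction with
  | h1 => exact ⟨0, 1, by simp⟩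
  | hm i y ih =>
    obtain ⟨N, p, h⟩ := ih
    exact ⟨N, p * gen padj i, by rw [← mul_assoc, h, map_mul, phi_gen]⟩
  | hi i y ih =>
    obtain ⟨N, p, h⟩ := ih
    obtain ⟨t, ht⟩ := gen_dvd_DD (ss_braid (m := m)) ss_far m i.val i.isLt le_rfl
    rw [ss_of_lt i.isLt] at ht
    have h1 : TT m = gen padj i * (t * DD (ss m) m) := by rw [← mul_assoc, ← ht]; rfl
    have h2 : (gg i)⁻¹ * phi m (TT m) = phi m (t * DD (ss m) m) := by
      rw [h1, map_mul, phi_gen, inv_mul_cancel_left]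
    refine ⟨N + 1, p * (t * DD (ss m) m), ?_⟩
    rw [map_mul, ← h, ← h2, pow_succ, mul_assoc, ← hc (y * (gg i)⁻¹)]
    simp only [mul_assoc]

theorem bg_center (hm : 2 ≤ m) :
    Subgroup.center (BG m) = Subgroup.zpowers (phi m (TT m)) := by
  apply le_antisymm
  · intro z hz
    obtain ⟨N, p, h⟩ := positive z
    have hpc : phi m p ∈ Subgroup.center (BG m) := by
      rw [← h]; exact Subgroup.mul_mem _ (Subgroup.pow_mem _ phiT_central _) hz
    have hp : ∀ i, gen padj i * p = p * gen padj (id i) := by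
      intro i
      apply phi_inj
      rw [map_mul, map_mul]
      exact Subgroup.mem_center_iff.1 hpc _
    obtain ⟨k, hk⟩ := quasi (by omega) _ p id le_rfl hp
    have hmem : phi m p ∈ Subgroup.zpowers (phi m (TT m)) := by
      rcases Nat.even_or_odd' k with ⟨j, rfl | rfl⟩
      · refine ⟨j, ?_⟩
        rw [hk, pow_mul, pow_two]
        simp [TT]
      · exfalso
        have hD : p = TT m ^ j * DD (ss m) m := by rw [hk, pow_succ, pow_mul, pow_two]; rfl
        have h0 := hp ⟨0, by omega⟩
        rw [hD, ← mul_assoc, TT_pow_comm, mul_assoc, mul_assoc] at h0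
        have h1 := cancel _ h0
        rw [gen_DD] at h1
        have h2 := cancel _ h1
        have h3 : gen padj (Fin.rev (⟨0, by omega⟩ : Fin m)) * 1 =
          gen padj (⟨0, by omega⟩ : Fin m) * 1 := by simpa using h2
        rcases gars 1 _ _ _ _ (by simp) h3 with ⟨h, _⟩ | ⟨_, _, c, h, _⟩ | ⟨_, _, c, h, _⟩
        · have := congrArg Fin.val h
          simp [Fin.val_rev] at this
          omega
        · have := congrArg (len padj) h
          simp at this
          omega
        · have := congrArg (len padj) h
          simp at this
          omega
    have : z = (phi m (TT m) ^ N)⁻¹ * phi m p := by rw [← h]; group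
    rw [this]
    exact Subgroup.mul_mem _ (Subgroup.inv_mem _ (Subgroup.pow_mem _ (Subgroup.mem_zpowers _) _))
      hmem
  · rw [Subgroup.zpowers_le]
    exact phiT_central

lemma bg_order (hm : 0 < m) (k : ℕ) (hk : 0 < k) : phi m (TT m) ^ k ≠ 1 := by
  intro h
  rw [← map_pow, ← map_one (phi m)] at h
  have h2 := congrArg (len padj) (phi_inj h)
  have := len_DD_pos hm
  simp [TT] at h2
  omega

lemma prod_ofFn_PP {G : Type} [Monoid G] (s : ℕ → G) (k : ℕ) :
    (List.ofFn fun i : Fin k => s i.val).prod = PP s k := by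
  induction k with
  | zero => simp [PP]
  | succ k ih => rw [List.ofFn_succ']; simp [PP, ih]

lemma phiT_eq : phi m (TT m) =
    ((List.ofFn fun i : Fin m => (PresentedGroup.of (rels := braidRels m) i : BG m)).prod) ^
      (m + 1) := by
  rw [TT, DD_sq ss_braid ss_far m le_rfl, map_pow, map_PP, ← prod_ofFn_PP]
  congr 3
  ext i
  rw [ss_of_lt i.isLt]
  rfl

end Path

end BraidCenter

/-- For `n ≥ 3` the center of the braid group `B_n` is infinite cyclic, generated
by the full twist `Δ² = (σ_1 ⋯ σ_{n−1})^n`. -/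
theorem center_braidGroup_eq_zpowers_fullTwist (n : ℕ) (hn : 3 ≤ n) :
    Subgroup.center (BraidGroup n) = Subgroup.zpowers (fullTwist n) ∧
    ∀ m : ℕ, 0 < m → fullTwist n ^ m ≠ 1 := by
  obtain ⟨m, rfl⟩ : ∃ m, n = m + 1 := ⟨n - 1, by omega⟩
  have h1 := BraidCenter.bg_center (m := m) (by omega)
  have h2 := BraidCenter.bg_order (m := m) (by omega)
  rw [BraidCenter.phiT_eq] at h1 h2
  exact ⟨h1, h2⟩
end

section
/- For the unweighted graph whose vertices are all OPT_n (outer planar triangulations of the based n-gon) and whose edges are diagonal flips, the isoperimetric constant k_n = min_{S} E(S,S̄)/min(|S|,|S̄|) satisfies k_n ≤ O(n^{−1/2}); consequently the valence-normalized Cheeger constant satisfies h_n ≤ O(n^{−3/2}). -/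
/-- An outer planar triangulation of the based, oriented convex `n`-gon
(vertices `0, …, n−1` in order, no interior vertices), encoded as its set of
`n − 3` pairwise non-crossing diagonals. -/
def IsOPT (n : ℕ) (T : Finset (Fin n × Fin n)) : Prop :=
  (∀ p ∈ T, p.1 < p.2 ∧ p.1.val + 2 ≤ p.2.val ∧ ¬(p.1.val = 0 ∧ p.2.val = n - 1)) ∧
  (∀ p ∈ T, ∀ q ∈ T,
    ¬((p.1.val < q.1.val ∧ q.1.val < p.2.val ∧ p.2.val < q.2.val) ∨
      (q.1.val < p.1.val ∧ p.1.val < q.2.val ∧ q.2.val < p.2.val))) ∧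
  T.card = n - 3

def OPT (n : ℕ) := {T : Finset (Fin n × Fin n) // IsOPT n T}

/-- Two outer planar triangulations are adjacent in the flip graph when they
differ by a single diagonal flip, i.e. by the exchange of exactly one diagonal. -/
def flipAdj {n : ℕ} (T T' : OPT n) : Prop :=
  (T.1 \ T'.1).card = 1 ∧ (T'.1 \ T.1).card = 1

/-- The weight of the cut between `S` and its complement in the flip graph:
the number of flip-graph edges from `S` to `S̄` (as ordered pairs). -/
noncomputable def cutCount {n : ℕ} (S : Set (OPT n)) : ℕ :=
  Set.ncard {e : OPT n × OPT n | e.1 ∈ S ∧ e.2 ∉ S ∧ flipAdj e.1 e.2}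

/-- The volume of `S`: the sum of flip-graph valences over `S`. -/
noncomputable def volCount {n : ℕ} (S : Set (OPT n)) : ℕ :=
  Set.ncard {e : OPT n × OPT n | e.1 ∈ S ∧ flipAdj e.1 e.2}


namespace FlipProof
open Finset

def Crs (p q : ℕ × ℕ) : Prop :=
  (p.1 < q.1 ∧ q.1 < p.2 ∧ p.2 < q.2) ∨ (q.1 < p.1 ∧ p.1 < q.2 ∧ q.2 < p.2)

def NC (a b : ℕ) (F : Finset (ℕ × ℕ)) : Prop :=
  (∀ p ∈ F, a ≤ p.1 ∧ p.1 + 2 ≤ p.2 ∧ p.2 ≤ b) ∧ ∀ p ∈ F, ∀ q ∈ F, ¬ Crs p q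

def res (F : Finset (ℕ × ℕ)) (x y : ℕ) : Finset (ℕ × ℕ) :=
  F.filter (fun p => x ≤ p.1 ∧ p.2 ≤ y)

def E (F : Finset (ℕ × ℕ)) (x y : ℕ) : Prop := (x, y) ∈ F ∨ y = x + 1

open Classical in
noncomputable def Tri (a b : ℕ) : Finset (Finset (ℕ × ℕ)) :=
  (powerset (Icc a b ×ˢ Icc a b)).filter (fun F => NC a b F ∧ F.card = b - a - 1)

lemma mem_Tri {a b : ℕ} {F : Finset (ℕ × ℕ)} :
    F ∈ Tri a b ↔ NC a b F ∧ F.card = b - a - 1 := by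
  simp only [Tri, mem_filter, mem_powerset]
  constructor
  · exact fun h => h.2
  · refine fun h => ⟨fun p hp => ?_, h⟩
    have := h.1.1 p hp
    rw [mem_product, mem_Icc, mem_Icc]
    omega

lemma mem_res {F : Finset (ℕ × ℕ)} {x y : ℕ} {p : ℕ × ℕ} :
    p ∈ res F x y ↔ p ∈ F ∧ x ≤ p.1 ∧ p.2 ≤ y := by
  unfold res; rw [mem_filter]

lemma NC.res {a b : ℕ} {F : Finset (ℕ × ℕ)} (h : NC a b F) (x y : ℕ) : NC x y (res F x y) := by
  refine ⟨fun p hp => ?_, fun p hp q hq => ?_⟩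
  · rw [mem_res] at hp
    have := h.1 p hp.1
    omega
  · rw [mem_res] at hp hq
    exact h.2 p hp.1 q hq.1

lemma exists_split {a b : ℕ} {F : Finset (ℕ × ℕ)} (h : NC a b F) (hab : a + 2 ≤ b) :
    ∃ k, a < k ∧ k < b ∧ ∀ p ∈ F, p = (a, b) ∨ p.2 ≤ k ∨ k ≤ p.1 := by
  classical
  by_cases hne : ∃ j, j < b ∧ (a, j) ∈ F
  · obtain ⟨j0, hj0⟩ := hne
    let J := (range b).filter (fun j => (a, j) ∈ F)
    have hJ : J.Nonempty := ⟨j0, by simp [J, hj0]⟩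
    obtain ⟨k, hk, hmax⟩ : ∃ k ∈ J, ∀ j ∈ J, j ≤ k :=
      ⟨_, J.max'_mem hJ, fun j hj => J.le_max' j hj⟩
    simp only [J, mem_filter, mem_range] at hk hmax
    have h1 := h.1 _ hk.2
    refine ⟨k, by simp at h1; omega, hk.1, ?_⟩
    rintro ⟨s, t⟩ hp
    have h2 := h.1 _ hp
    have h3 := h.2 _ hk.2 _ hp
    simp only [Crs] at h1 h2 h3
    by_contra hcon
    simp only [Prod.mk.injEq, not_or, not_le] at hcon
    have hsa : s = a := by omega
    subst hsa
    have := hmax t ⟨by omega, hp⟩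
    omega
  · push Not at hne
    refine ⟨a + 1, by omega, by omega, ?_⟩
    rintro ⟨s, t⟩ hp
    have h2 := h.1 _ hp
    simp only at h2
    by_contra hcon
    simp only [Prod.mk.injEq, not_or, not_le] at hcon
    have hsa : s = a := by omega
    subst hsa
    exact hne t (by omega) hp

lemma sub_split {a b k : ℕ} {F : Finset (ℕ × ℕ)}
    (hk : ∀ p ∈ F, p = (a, b) ∨ p.2 ≤ k ∨ k ≤ p.1) (h : NC a b F) :
    F ⊆ {(a, b)} ∪ (res F a k ∪ res F k b) := by
  intro p hp
  have h1 := h.1 p hp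
  simp only [mem_union, mem_singleton, mem_res]
  rcases hk p hp with h | h | h
  · exact Or.inl h
  · exact Or.inr (Or.inl ⟨hp, by omega, h⟩)
  · exact Or.inr (Or.inr ⟨hp, h, by omega⟩)

lemma card_le {a b : ℕ} {F : Finset (ℕ × ℕ)} (h : NC a b F) : F.card ≤ b - a - 1 := by
  induction hn : b - a using Nat.strong_induction_on generalizing a b F with
  | _ n ih =>
    by_cases hab : a + 2 ≤ b
    · obtain ⟨k, h1, h2, hk⟩ := exists_split h hab
      have e1 := ih (k - a) (by omega) (h.res a k) rfl
      have e2 := ih (b - k) (by omega) (h.res k b) rfl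
      have e3 := Finset.card_le_card (sub_split hk h)
      have e4 := card_union_le {(a, b)} (res F a k ∪ res F k b)
      have e5 := card_union_le (res F a k) (res F k b)
      rw [card_singleton] at e4
      omega
    · have : F = ∅ := by
        rw [eq_empty_iff_forall_notMem]
        intro p hp
        have := h.1 p hp
        omega
      simp [this]

lemma Tri_max {a b : ℕ} {F : Finset (ℕ × ℕ)} (h : F ∈ Tri a b) {p : ℕ × ℕ}
    (h1 : a ≤ p.1 ∧ p.1 + 2 ≤ p.2 ∧ p.2 ≤ b) (h2 : ∀ q ∈ F, ¬ Crs p q) : p ∈ F := by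
  by_contra hp
  rw [mem_Tri] at h
  have hN : NC a b (insert p F) := by
    refine ⟨?_, ?_⟩
    · intro q hq
      rcases mem_insert.1 hq with rfl | hq
      · exact h1
      · exact h.1.1 q hq
    · intro q hq r hr
      rcases mem_insert.1 hq with e | hq' <;> rcases mem_insert.1 hr with e' | hr'
      · subst e; subst e'; unfold Crs; omega
      · subst e; exact h2 r hr'
      · subst e'
        have := h2 q hq'
        unfold Crs at *; omega
      · exact h.1.2 q hq' r hr'
  have := card_le hN
  rw [card_insert_of_notMem hp] at this
  omega

lemma Tri_top {a b : ℕ} {F : Finset (ℕ × ℕ)} (h : F ∈ Tri a b) (hab : a + 2 ≤ b) : (a, b) ∈ F := by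
  refine Tri_max h (by simp; omega) ?_
  intro q hq
  have := (mem_Tri.1 h).1.1 q hq
  unfold Crs; simp only; omega

lemma Tri_E {a b : ℕ} {F : Finset (ℕ × ℕ)} (h : F ∈ Tri a b) (hab : a < b) : E F a b := by
  by_cases h2 : a + 2 ≤ b
  · exact Or.inl (Tri_top h h2)
  · exact Or.inr (by omega)

lemma Tri_split {a b : ℕ} {F : Finset (ℕ × ℕ)} (h : F ∈ Tri a b) (hab : a + 2 ≤ b) :
    ∃ k, a < k ∧ k < b ∧ res F a k ∈ Tri a k ∧ res F k b ∈ Tri k b ∧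
      F = {(a, b)} ∪ (res F a k ∪ res F k b) := by
  have h' := mem_Tri.1 h
  obtain ⟨k, h1, h2, hk⟩ := exists_split h'.1 hab
  have e1 := card_le (h'.1.res a k)
  have e2 := card_le (h'.1.res k b)
  have e3 := Finset.card_le_card (sub_split hk h'.1)
  have e4 := card_union_le {(a, b)} (res F a k ∪ res F k b)
  have e5 := card_union_le (res F a k) (res F k b)
  rw [card_singleton] at e4
  refine ⟨k, h1, h2, mem_Tri.2 ⟨h'.1.res a k, by omega⟩, mem_Tri.2 ⟨h'.1.res k b, by omega⟩, ?_⟩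
  refine Subset.antisymm (sub_split hk h'.1) ?_
  intro p hp
  simp only [mem_union, mem_singleton, mem_res] at hp
  rcases hp with rfl | h | h
  · exact Tri_top h hab
  · exact h.1
  · exact h.1

lemma E_mono {F G : Finset (ℕ × ℕ)} (h : F ⊆ G) {x y : ℕ} (hE : E F x y) : E G x y :=
  hE.imp (fun h' => h h') id

lemma res_sub (F : Finset (ℕ × ℕ)) (x y : ℕ) : res F x y ⊆ F := filter_subset _ _

/-- every chord has an apex below it -/
lemma Tri_apex {a b : ℕ} {F : Finset (ℕ × ℕ)} (h : F ∈ Tri a b) {x y : ℕ} (hxy : (x, y) ∈ F) :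
    ∃ k, x < k ∧ k < y ∧ E F x k ∧ E F k y := by
  induction hn : b - a using Nat.strong_induction_on generalizing a b F with
  | _ n ih =>
    have h0 := (mem_Tri.1 h).1.1 _ hxy
    simp only at h0
    obtain ⟨k, h1, h2, h3, h4, h5⟩ := Tri_split h (by omega)
    have hx := hxy
    rw [h5] at hx
    simp only [mem_union, mem_singleton] at hx
    rcases hx with hx | hx | hx
    · simp only [Prod.mk.injEq] at hx
      obtain ⟨rfl, rfl⟩ := hx
      exact ⟨k, h1, h2, E_mono (res_sub _ _ _) (Tri_E h3 h1), E_mono (res_sub _ _ _) (Tri_E h4 h2)⟩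
    · obtain ⟨j, i1, i2, i3, i4⟩ := ih (k - a) (by omega) h3 hx rfl
      exact ⟨j, i1, i2, E_mono (res_sub _ _ _) i3, E_mono (res_sub _ _ _) i4⟩
    · obtain ⟨j, i1, i2, i3, i4⟩ := ih (b - k) (by omega) h4 hx rfl
      exact ⟨j, i1, i2, E_mono (res_sub _ _ _) i3, E_mono (res_sub _ _ _) i4⟩

lemma glue {a k b : ℕ} (h1 : a < k) (h2 : k < b) {F G : Finset (ℕ × ℕ)} (hF : F ∈ Tri a k)
    (hG : G ∈ Tri k b) :
    {(a, b)} ∪ (F ∪ G) ∈ Tri a b ∧ res ({(a, b)} ∪ (F ∪ G)) a k = F ∧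
      res ({(a, b)} ∪ (F ∪ G)) k b = G := by
  rw [mem_Tri] at hF hG
  refine ⟨mem_Tri.2 ⟨⟨?_, ?_⟩, ?_⟩, ?_, ?_⟩
  · intro p hp
    simp only [mem_union, mem_singleton] at hp
    rcases hp with rfl | hp | hp
    · simp only; omega
    · have := hF.1.1 p hp; omega
    · have := hG.1.1 p hp; omega
  · intro p hp q hq
    simp only [mem_union, mem_singleton] at hp hq
    have f1 := fun p hp => hF.1.1 p hp
    have g1 := fun p hp => hG.1.1 p hp
    rcases hp with rfl | hp | hp <;> rcases hq with rfl | hq | hq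
    · simp only [Crs]; omega
    · have := f1 _ hq; simp only [Crs]; omega
    · have := g1 _ hq; simp only [Crs]; omega
    · have := f1 _ hp; simp only [Crs]; omega
    · exact hF.1.2 p hp q hq
    · have := f1 _ hp; have := g1 _ hq; simp only [Crs]; omega
    · have := g1 _ hp; simp only [Crs]; omega
    · have := g1 _ hp; have := f1 _ hq; simp only [Crs]; omega
    · exact hG.1.2 p hp q hq
  · rw [card_union_of_disjoint, card_union_of_disjoint, hF.2, hG.2, card_singleton]
    · omega
    · rw [disjoint_left]
      intro p hp hq
      have := hF.1.1 _ hp; have := hG.1.1 _ hq; omega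
    · rw [disjoint_singleton_left, mem_union]
      rintro (hp | hp)
      · have := hF.1.1 _ hp; simp only at this; omega
      · have := hG.1.1 _ hp; simp only at this; omega
  · ext p
    simp only [mem_res, mem_union, mem_singleton]
    constructor
    · rintro ⟨rfl | hp | hp, h⟩
      · simp only at h; omega
      · exact hp
      · have := hG.1.1 _ hp; omega
    · intro hp
      have := hF.1.1 _ hp
      exact ⟨Or.inr (Or.inl hp), by omega⟩
  · ext p
    simp only [mem_res, mem_union, mem_singleton]
    constructor
    · rintro ⟨rfl | hp | hp, h⟩
      · simp only at h; omega
      · have := hF.1.1 _ hp; omega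
      · exact hp
    · intro hp
      have := hG.1.1 _ hp
      exact ⟨Or.inr (Or.inr hp), by omega⟩

lemma card_Tri_rec {a b : ℕ} (hab : a + 2 ≤ b) :
    (Tri a b).card = ∑ k ∈ Ioo a b, (Tri a k).card * (Tri k b).card := by
  classical
  have hU : Tri a b = (Ioo a b).biUnion (fun k =>
      ((Tri a k) ×ˢ (Tri k b)).image (fun P => {(a, b)} ∪ (P.1 ∪ P.2))) := by
    ext F
    simp only [mem_biUnion, mem_image, mem_product, mem_Ioo, Prod.exists]
    constructor
    · intro h
      obtain ⟨k, h1, h2, h3, h4, h5⟩ := Tri_split h hab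
      exact ⟨k, ⟨h1, h2⟩, _, _, ⟨h3, h4⟩, h5.symm⟩
    · rintro ⟨k, ⟨h1, h2⟩, A, B, ⟨h3, h4⟩, rfl⟩
      exact (glue h1 h2 h3 h4).1
  rw [hU, card_biUnion]
  · refine sum_congr rfl fun k hk => ?_
    rw [mem_Ioo] at hk
    rw [card_image_of_injOn, card_product]
    rintro ⟨A, B⟩ hP ⟨A', B'⟩ hP' heq
    simp only [coe_product, Set.mem_prod, mem_coe] at hP hP' heq
    have g1 := glue hk.1 hk.2 hP.1 hP.2
    have g2 := glue hk.1 hk.2 hP'.1 hP'.2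
    rw [heq] at g1
    rw [Prod.mk.injEq]
    exact ⟨g1.2.1.symm.trans g2.2.1, g1.2.2.symm.trans g2.2.2⟩
  · have key : ∀ k ∈ Ioo a b, ∀ k' ∈ Ioo a b, k < k' → Disjoint
        (((Tri a k) ×ˢ (Tri k b)).image (fun P => ({(a, b)} ∪ (P.1 ∪ P.2) : Finset (ℕ × ℕ))))
        (((Tri a k') ×ˢ (Tri k' b)).image (fun P => {(a, b)} ∪ (P.1 ∪ P.2))) := by
      intro k hk k' hk' hlt
      rw [mem_Ioo] at hk hk'
      rw [disjoint_left]
      intro F hF hF'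
      simp only [mem_image, mem_product, Prod.exists] at hF hF'
      obtain ⟨A, B, ⟨hA, hB⟩, rfl⟩ := hF
      obtain ⟨A', B', ⟨hA', hB'⟩, heq⟩ := hF'
      have t1 := Tri_top hB (by omega)
      have t2 := Tri_top hA' (by omega)
      have g1 := (mem_Tri.1 (glue hk.1 hk.2 hA hB).1).1.2
      have m1 : (k, b) ∈ ({(a, b)} ∪ (A ∪ B) : Finset (ℕ × ℕ)) := by simp [t1]
      have m2 : (a, k') ∈ ({(a, b)} ∪ (A ∪ B) : Finset (ℕ × ℕ)) := by rw [← heq]; simp [t2]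
      have := g1 _ m1 _ m2
      simp only [Crs] at this
      omega
    intro k hk k' hk' hne
    rcases lt_or_gt_of_ne hne with h | h
    · exact key k hk k' hk' h
    · exact (key k' hk' k hk h).symm

lemma card_Tri {a b : ℕ} (hab : a < b) : (Tri a b).card = catalan (b - a - 1) := by
  induction hn : b - a using Nat.strong_induction_on generalizing a b with
  | _ n ih =>
    subst hn
    by_cases h2 : a + 2 ≤ b
    · rw [card_Tri_rec h2]
      obtain ⟨m, rfl⟩ : ∃ m, b = a + 2 + m := ⟨b - (a + 2), by omega⟩
      rw [show a + 2 + m - a - 1 = m + 1 by omega, catalan_succ,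
        Fin.sum_univ_eq_sum_range (fun i => catalan i * catalan (m - i)) m.succ]
      refine (Finset.sum_bij (fun i _ => a + 1 + i) ?_ ?_ ?_ ?_).symm
      · intro i hi; rw [mem_range] at hi; rw [mem_Ioo]; omega
      · intro i _ j _ h; simpa using h
      · intro k hk; rw [mem_Ioo] at hk; exact ⟨k - (a + 1), by rw [mem_range]; omega, by omega⟩
      · intro i hi
        rw [mem_range] at hi
        rw [ih (a + 1 + i - a) (by omega) (by omega) rfl,
          ih (a + 2 + m - (a + 1 + i)) (by omega) (by omega) rfl]
        congr 2 <;> omega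
    · have hb : b = a + 1 := by omega
      subst hb
      have : Tri a (a + 1) = {∅} := by
        ext F
        rw [mem_Tri, mem_singleton]
        constructor
        · intro h
          rw [← card_eq_zero, h.2]; omega
        · rintro rfl
          simp [NC]
      rw [this]
      simp

lemma hex {N q1 q2 q3 : ℕ} (h1 : 1 ≤ q1) (h12 : q1 < q2) (h23 : q2 < q3) (h3 : q3 ≤ N)
    {F : Finset (ℕ × ℕ)} (hF : F ∈ Tri 0 N)
    (hA : ∀ x y, (x, y) ∈ F → x < q1 → q2 ≤ y → y < q3 → False) :
    ∃ b d, (b, d) ∈ F ∧ q1 ≤ b ∧ b < q2 ∧ q3 ≤ d ∧ d ≤ N := by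
  have key : ∀ m x y, y - x = m → (x, y) ∈ F → x < q1 → q3 ≤ y →
      ∃ b d, (b, d) ∈ F ∧ q1 ≤ b ∧ b < q2 ∧ q3 ≤ d ∧ d ≤ N := by
    intro m
    induction m using Nat.strong_induction_on with
    | _ m ih =>
      intro x y hm hxy hx hy
      have hb := (mem_Tri.1 hF).1.1 _ hxy
      simp only at hb
      obtain ⟨k, k1, k2, k3, k4⟩ := Tri_apex hF hxy
      by_cases c1 : k < q1
      · rcases k4 with k4 | k4
        · exact ih (y - k) (by omega) k y rfl k4 c1 hy
        · omega
      by_cases c2 : k < q2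
      · rcases k4 with k4 | k4
        · exact ⟨k, y, k4, by omega, c2, hy, hb.2.2⟩
        · omega
      by_cases c3 : k < q3
      · rcases k3 with k3 | k3
        · exact (hA x k k3 hx (by omega) c3).elim
        · omega
      · rcases k3 with k3 | k3
        · exact ih (k - x) (by omega) x k rfl k3 hx (by omega)
        · omega
  exact key _ 0 N rfl (Tri_top hF (by omega)) (by omega) h3

lemma flip_chord {N : ℕ} {F : Finset (ℕ × ℕ)} (hF : F ∈ Tri 0 N) {p : ℕ × ℕ} (hp : p ∈ F)
    (hne : p ≠ (0, N)) :
    ∃ r : ℕ × ℕ, (r.1 + 2 ≤ r.2 ∧ r.2 ≤ N) ∧ Crs p r ∧ ∀ q ∈ F, q ≠ p → ¬ Crs r q := by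
  classical
  obtain ⟨s, t⟩ := p
  have hF' := (mem_Tri.1 hF).1
  have hst := hF'.1 _ hp
  simp only at hst
  have hC : (F.filter (fun q => q.1 ≤ s ∧ t ≤ q.2 ∧ q ≠ (s, t))).Nonempty := by
    refine ⟨(0, N), ?_⟩
    rw [mem_filter]
    exact ⟨Tri_top hF (by omega), by simp, by simp; omega, hne.symm⟩
  obtain ⟨⟨x, y⟩, hq, hmin⟩ := exists_min_image _ (fun q : ℕ × ℕ => q.2 - q.1) hC
  simp only [mem_filter, ne_eq, Prod.mk.injEq, and_imp, Prod.forall] at hq hmin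
  obtain ⟨hq, hxs, hty, hqne⟩ := hq
  have hxy := hF'.1 _ hq
  simp only at hxy
  obtain ⟨k, k1, k2, k3, k4⟩ := Tri_apex hF hq
  obtain ⟨j, j1, j2, j3, j4⟩ := Tri_apex hF hp
  have hcases : t ≤ k ∨ k ≤ s := by
    by_contra hcon
    have a1 : (x, k) ∈ F → ¬ Crs (x, k) (s, t) := fun h => hF'.2 _ h _ hp
    have a2 : (k, y) ∈ F → ¬ Crs (k, y) (s, t) := fun h => hF'.2 _ h _ hp
    simp only [Crs] at a1 a2
    unfold E at k3 k4
    rcases k3 with k3 | k3 <;> rcases k4 with k4 | k4 <;>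
      [have := a1 k3; have := a1 k3; have := a2 k4; skip] <;> [have := a2 k4; skip; skip; skip] <;>
      omega
  have nc : ∀ {u v w z : ℕ}, E F u v → (w, z) ∈ F → ¬ Crs (u, v) (w, z) := by
    intro u v w z h h'
    rcases h with h | h
    · exact hF'.2 _ h _ h'
    · simp only [Crs]
      have := hF'.1 _ h'
      simp only at this
      omega
  rcases hcases with hc | hc
  · have e : x = s ∧ k = t := by
      by_contra hcon
      rcases k3 with k3 | k3
      · have := hmin x k k3 hxs hc (by omega)
        omega
      · omega
    obtain ⟨rfl, rfl⟩ := e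
    refine ⟨(j, y), by simp only; omega, by simp only [Crs]; omega, ?_⟩
    rintro ⟨u, v⟩ huv hne'
    have n1 := nc (Or.inl hq) huv
    have n2 := nc k3 huv
    have n3 := nc k4 huv
    have n4 := nc j3 huv
    have n5 := nc j4 huv
    have n6 := hF'.1 _ huv
    simp only [Crs, ne_eq, Prod.mk.injEq] at *
    omega
  · have e : k = s ∧ y = t := by
      by_contra hcon
      rcases k4 with k4 | k4
      · have := hmin k y k4 hc hty (by omega)
        omega
      · omega
    obtain ⟨rfl, rfl⟩ := e
    refine ⟨(x, j), by simp only; omega, by simp only [Crs]; omega, ?_⟩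
    rintro ⟨u, v⟩ huv hne'
    have n1 := nc (Or.inl hq) huv
    have n2 := nc k3 huv
    have n3 := nc k4 huv
    have n4 := nc j3 huv
    have n5 := nc j4 huv
    have n6 := hF'.1 _ huv
    simp only [Crs, ne_eq, Prod.mk.injEq] at *
    omega

lemma exists_flip {N : ℕ} {F : Finset (ℕ × ℕ)} (hF : F ∈ Tri 0 N) {p : ℕ × ℕ} (hp : p ∈ F)
    (hne : p ≠ (0, N)) :
    ∃ F' ∈ Tri 0 N, F \ F' = {p} ∧ (F' \ F).card = 1 := by
  obtain ⟨r, hr, hpr, hnc⟩ := flip_chord hF hp hne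
  have hF' := mem_Tri.1 hF
  have hrF : r ∉ F := fun h => hF'.1.2 _ hp _ h hpr
  have hrp : r ≠ p := fun h => hrF (h ▸ hp)
  refine ⟨insert r (F.erase p), mem_Tri.2 ⟨⟨?_, ?_⟩, ?_⟩, ?_, ?_⟩
  · intro q hq
    rcases mem_insert.1 hq with e | hq'
    · subst e; omega
    · exact hF'.1.1 q (mem_of_mem_erase hq')
  · intro q hq q' hq'
    rcases mem_insert.1 hq with e | h <;> rcases mem_insert.1 hq' with e' | h'
    · subst e; subst e'; unfold Crs; omega
    · subst e; exact hnc q' (mem_of_mem_erase h') (ne_of_mem_erase h')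
    · subst e'
      have := hnc q (mem_of_mem_erase h) (ne_of_mem_erase h)
      unfold Crs at *; omega
    · exact hF'.1.2 _ (mem_of_mem_erase h) _ (mem_of_mem_erase h')
  · rw [card_insert_of_notMem (fun h => hrF (mem_of_mem_erase h)), card_erase_of_mem hp]
    have := card_pos.2 ⟨p, hp⟩
    omega
  · ext q
    simp only [mem_sdiff, mem_insert, mem_erase, mem_singleton]
    constructor
    · rintro ⟨h1, h2⟩
      by_contra h
      exact h2 (Or.inr ⟨h, h1⟩)
    · rintro rfl
      exact ⟨hp, by rintro (h | h); exact hrp h.symm; exact h.1 rfl⟩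
  · rw [card_eq_one]
    refine ⟨r, ?_⟩
    ext q
    simp only [mem_sdiff, mem_insert, mem_erase, mem_singleton]
    constructor
    · rintro ⟨h1 | h1, h2⟩
      · exact h1
      · exact (h2 h1.2).elim
    · rintro rfl
      exact ⟨Or.inl rfl, hrF⟩

/-- contraction of the interval `[a, d]` to a side -/
def phi (a d x : ℕ) : ℕ := if x ≤ a then x else x - (d - a) + 1

/-- expansion of a side to the interval `[a, d]` -/
def psi (a d x : ℕ) : ℕ := if x ≤ a then x else x + (d - a) - 1

def outer (a d : ℕ) (F : Finset (ℕ × ℕ)) : Finset (ℕ × ℕ) :=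
  F.filter (fun p => ¬ (a ≤ p.1 ∧ p.2 ≤ d))

lemma psi_phi {a d x : ℕ} (had : a < d) (hx : x ≤ a ∨ d ≤ x) : psi a d (phi a d x) = x := by
  unfold psi phi
  split_ifs <;> omega

lemma contract {a d N : ℕ} (had : a < d) (hd : d ≤ N) {G : Finset (ℕ × ℕ)} (hG : NC 0 N G)
    (ho : ∀ p ∈ G, (p.1 ≤ a ∨ d ≤ p.1) ∧ (p.2 ≤ a ∨ d ≤ p.2) ∧ ¬ (a ≤ p.1 ∧ p.2 ≤ d)) :
    NC 0 (N - (d - a) + 1) (G.image (Prod.map (phi a d) (phi a d))) ∧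
    (G.image (Prod.map (phi a d) (phi a d))).image (Prod.map (psi a d) (psi a d)) = G ∧
    (G.image (Prod.map (phi a d) (phi a d))).card = G.card := by
  have hinv : ∀ p ∈ G, Prod.map (psi a d) (psi a d) (Prod.map (phi a d) (phi a d) p) = p := by
    intro p hp
    have := ho p hp
    ext
    · exact psi_phi had this.1
    · exact psi_phi had this.2.1
  refine ⟨⟨?_, ?_⟩, ?_, ?_⟩
  · intro p hp
    obtain ⟨⟨s, t⟩, hq, rfl⟩ := mem_image.1 hp
    have h1 := ho _ hq
    have h2 := hG.1 _ hq
    simp only [Prod.map, phi] at *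
    split_ifs <;> omega
  · intro p hp q hq
    obtain ⟨⟨s, t⟩, hp', rfl⟩ := mem_image.1 hp
    obtain ⟨⟨u, v⟩, hq', rfl⟩ := mem_image.1 hq
    have h1 := ho _ hp'
    have h2 := ho _ hq'
    have h3 := hG.2 _ hp' _ hq'
    simp only [Prod.map, phi, Crs] at *
    split_ifs <;> omega
  · rw [image_image]
    ext p
    simp only [mem_image, Function.comp]
    constructor
    · rintro ⟨q, hq, rfl⟩
      rw [hinv q hq]; exact hq
    · intro hp
      exact ⟨p, hp, hinv p hp⟩
  · apply card_image_of_injOn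
    intro p hp q hq h
    rw [← hinv p hp, ← hinv q hq, h]

open Classical in
noncomputable def Quad (N a b c d : ℕ) : Finset (Finset (ℕ × ℕ)) :=
  (Tri 0 N).filter (fun F => (a, c) ∈ F ∧ ∀ p ∈ F, p ≠ (a, c) → ¬ Crs (b, d) p)

lemma quad_struct {N a b c d : ℕ} (hab : a < b) (hbc : b < c) (hcd : c < d) (hd : d ≤ N)
    {F : Finset (ℕ × ℕ)} (hF : F ∈ Quad N a b c d) :
    res F a b ∈ Tri a b ∧ res F b c ∈ Tri b c ∧ res F c d ∈ Tri c d ∧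
    (outer a d F).image (Prod.map (phi a d) (phi a d)) ∈ Tri 0 (N - (d - a) + 1) ∧
    F = {(a, d), (a, c)} ∪ (res F a b ∪ (res F b c ∪ (res F c d ∪
      ((outer a d F).image (Prod.map (phi a d) (phi a d))).image
        (Prod.map (psi a d) (psi a d))))) := by
  simp only [Quad, mem_filter] at hF
  obtain ⟨hT, hac, hbd⟩ := hF
  obtain ⟨hN, hcard⟩ := mem_Tri.1 hT
  have hO : NC 0 N (outer a d F) := by
    refine ⟨fun p hp => hN.1 p (mem_of_mem_filter p hp), fun p hp q hq =>
      hN.2 p (mem_of_mem_filter p hp) q (mem_of_mem_filter q hq)⟩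
  have ho : ∀ p ∈ outer a d F,
      (p.1 ≤ a ∨ d ≤ p.1) ∧ (p.2 ≤ a ∨ d ≤ p.2) ∧ ¬ (a ≤ p.1 ∧ p.2 ≤ d) := by
    rintro ⟨s, t⟩ hp
    obtain ⟨hp, hn⟩ := mem_filter.1 hp
    have h1 := hN.1 _ hp
    have h2 := hN.2 _ hac _ hp
    have h3 := hbd _ hp
    simp only [Crs, ne_eq, Prod.mk.injEq] at *
    omega
  obtain ⟨c1, c2, c3⟩ := contract (hab.trans (hbc.trans hcd)) hd hO ho
  rw [c2]
  have hsub : F ⊆ {(a, d), (a, c)} ∪ (res F a b ∪ (res F b c ∪ (res F c d ∪ outer a d F))) := by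
    rintro ⟨s, t⟩ hp
    have h1 := hN.1 _ hp
    have h2 := hN.2 _ hac _ hp
    have h3 := hbd _ hp
    simp only [mem_union, mem_insert, mem_singleton, mem_res, outer, mem_filter, hp, true_and]
    simp only [Crs, ne_eq, Prod.mk.injEq] at *
    omega
  have e1 := card_le (hN.res a b)
  have e2 := card_le (hN.res b c)
  have e3 := card_le (hN.res c d)
  have e4 := card_le c1
  have u0 := card_union_le {(a, d), (a, c)} (res F a b ∪ (res F b c ∪ (res F c d ∪ outer a d F)))
  have u1 := card_union_le (res F a b) (res F b c ∪ (res F c d ∪ outer a d F))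
  have u2 := card_union_le (res F b c) (res F c d ∪ outer a d F)
  have u3 := card_union_le (res F c d) (outer a d F)
  have u4 : ({(a, d), (a, c)} : Finset (ℕ × ℕ)).card ≤ 2 := card_le_two
  have u5 := card_le_card hsub
  refine ⟨mem_Tri.2 ⟨hN.res _ _, by omega⟩, mem_Tri.2 ⟨hN.res _ _, by omega⟩,
    mem_Tri.2 ⟨hN.res _ _, by omega⟩, mem_Tri.2 ⟨c1, by omega⟩, ?_⟩
  exact eq_of_subset_of_card_le hsub (by omega)

lemma card_Quad {N a b c d : ℕ} (hab : a < b) (hbc : b < c) (hcd : c < d) (hd : d ≤ N) :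
    (Quad N a b c d).card ≤ catalan (b - a - 1) * (catalan (c - b - 1) *
      (catalan (d - c - 1) * catalan (N - (d - a)))) := by
  have e : catalan (N - (d - a)) = (Tri 0 (N - (d - a) + 1)).card := by
    rw [card_Tri (by omega)]; congr 1
  rw [e, ← card_Tri hab, ← card_Tri hbc, ← card_Tri hcd, ← card_product, ← card_product,
    ← card_product]
  refine card_le_card_of_injOn (fun F => (res F a b, res F b c, res F c d,
    (outer a d F).image (Prod.map (phi a d) (phi a d)))) ?_ ?_
  · intro F hF
    obtain ⟨h1, h2, h3, h4, -⟩ := quad_struct hab hbc hcd hd hF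
    simp only [coe_product, Set.mem_prod, mem_coe]
    exact ⟨h1, h2, h3, h4⟩
  · intro F hF F' hF' h
    obtain ⟨-, -, -, -, h5⟩ := quad_struct hab hbc hcd hd hF
    obtain ⟨-, -, -, -, h5'⟩ := quad_struct hab hbc hcd hd hF'
    simp only [Prod.mk.injEq] at h
    obtain ⟨i1, i2, i3, i4⟩ := h
    rw [h5, h5', i1, i2, i3, i4]

lemma psi_inj {a d : ℕ} (had : a < d) : Function.Injective (psi a d) := by
  intro x y h
  unfold psi at h
  split_ifs at h <;> omega

lemma expand {N a c : ℕ} (hac : a + 2 ≤ c) (hc : c ≤ N) {H G : Finset (ℕ × ℕ)}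
    (hH : H ∈ Tri a c) (hG : G ∈ Tri 0 (N - (c - a) + 1)) :
    H ∪ G.image (Prod.map (psi a c) (psi a c)) ∈ Tri 0 N ∧
    res (H ∪ G.image (Prod.map (psi a c) (psi a c))) a c = H ∧
    outer a c (H ∪ G.image (Prod.map (psi a c) (psi a c))) =
      G.image (Prod.map (psi a c) (psi a c)) := by
  have hH' := mem_Tri.1 hH
  have hG' := mem_Tri.1 hG
  have f1 : ∀ p ∈ H, a ≤ p.1 ∧ p.1 + 2 ≤ p.2 ∧ p.2 ≤ c := hH'.1.1
  have g1 : ∀ p ∈ G.image (Prod.map (psi a c) (psi a c)),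
      p.1 + 2 ≤ p.2 ∧ p.2 ≤ N ∧ (p.1 ≤ a ∨ c ≤ p.1) ∧ (p.2 ≤ a ∨ c ≤ p.2) ∧
      ¬ (a ≤ p.1 ∧ p.2 ≤ c) := by
    intro p hp
    obtain ⟨⟨s, t⟩, hq, rfl⟩ := mem_image.1 hp
    have h2 := hG'.1.1 _ hq
    simp only [Prod.map, psi] at *
    split_ifs <;> omega
  have g2 : ∀ p ∈ G.image (Prod.map (psi a c) (psi a c)),
      ∀ q ∈ G.image (Prod.map (psi a c) (psi a c)), ¬ Crs p q := by
    intro p hp q hq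
    obtain ⟨⟨s, t⟩, hp', rfl⟩ := mem_image.1 hp
    obtain ⟨⟨u, v⟩, hq', rfl⟩ := mem_image.1 hq
    have h3 := hG'.1.2 _ hp' _ hq'
    simp only [Prod.map, psi, Crs] at *
    split_ifs <;> omega
  have hcard : (G.image (Prod.map (psi a c) (psi a c))).card = G.card := by
    apply card_image_of_injective
    exact (psi_inj (by omega)).prodMap (psi_inj (by omega))
  generalize G.image (Prod.map (psi a c) (psi a c)) = K at *
  refine ⟨mem_Tri.2 ⟨⟨?_, ?_⟩, ?_⟩, ?_, ?_⟩
  · intro p hp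
    rcases mem_union.1 hp with hp | hp
    · have := f1 p hp; omega
    · have := g1 p hp; omega
  · intro p hp q hq
    rcases mem_union.1 hp with hp | hp <;> rcases mem_union.1 hq with hq | hq
    · exact hH'.1.2 p hp q hq
    · have := f1 p hp; have := g1 q hq; unfold Crs; omega
    · have := f1 q hq; have := g1 p hp; unfold Crs; omega
    · exact g2 p hp q hq
  · rw [card_union_of_disjoint, hcard, hH'.2, hG'.2]
    · omega
    · rw [disjoint_left]
      intro p hp hq
      have := f1 p hp; have := g1 p hq; omega
  · ext p
    simp only [mem_res, mem_union]
    constructor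
    · rintro ⟨hp | hp, h⟩
      · exact hp
      · have := g1 p hp; omega
    · intro hp
      have := f1 p hp
      exact ⟨Or.inl hp, by omega⟩
  · ext p
    simp only [outer, mem_filter, mem_union]
    constructor
    · rintro ⟨hp | hp, h⟩
      · have := f1 p hp; omega
      · exact hp
    · intro hp
      have := g1 p hp
      exact ⟨Or.inr hp, by omega⟩

open Classical in
noncomputable def Trg (N a b c : ℕ) : Finset (Finset (ℕ × ℕ)) :=
  (Tri 0 N).filter (fun F => (a, c) ∈ F ∧ E F a b ∧ E F b c)

lemma mem_Trg {N a b c : ℕ} {F : Finset (ℕ × ℕ)} :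
    F ∈ Trg N a b c ↔ F ∈ Tri 0 N ∧ (a, c) ∈ F ∧ E F a b ∧ E F b c := by
  simp only [Trg, mem_filter]

lemma card_Trg {N a b c : ℕ} (hab : a < b) (hbc : b < c) (hc : c ≤ N) :
    catalan (b - a - 1) * (catalan (c - b - 1) * catalan (N - (c - a))) ≤ (Trg N a b c).card := by
  have e : catalan (N - (c - a)) = (Tri 0 (N - (c - a) + 1)).card := by
    rw [card_Tri (by omega)]; congr 1
  rw [e, ← card_Tri hab, ← card_Tri hbc, ← card_product, ← card_product]
  refine card_le_card_of_injOn (fun P => ({(a, c)} ∪ (P.1 ∪ P.2.1)) ∪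
    P.2.2.image (Prod.map (psi a c) (psi a c))) ?_ ?_
  · rintro ⟨A, B, G⟩ hP
    simp only [coe_product, Set.mem_prod, mem_coe] at hP
    obtain ⟨hA, hB, hG⟩ := hP
    have g := (glue hab hbc hA hB).1
    have x := (expand (by omega) hc g hG).1
    simp only [mem_coe]
    rw [mem_Trg]
    refine ⟨x, by simp, E_mono ?_ (Tri_E hA hab), E_mono ?_ (Tri_E hB hbc)⟩
    · intro p hp; simp [hp]
    · intro p hp; simp [hp]
  · rintro ⟨A, B, G⟩ hP ⟨A', B', G'⟩ hP' h
    simp only [coe_product, Set.mem_prod, mem_coe] at hP hP' h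
    obtain ⟨hA, hB, hG⟩ := hP
    obtain ⟨hA', hB', hG'⟩ := hP'
    have g := glue hab hbc hA hB
    have x := expand (by omega) hc g.1 hG
    have g' := glue hab hbc hA' hB'
    have x' := expand (by omega) hc g'.1 hG'
    rw [h] at x
    have i1 := x.2.1.symm.trans x'.2.1
    have i2 := x.2.2.symm.trans x'.2.2
    rw [i1] at g
    have i3 := g.2.1.symm.trans g'.2.1
    have i4 := g.2.2.symm.trans g'.2.2
    have i5 := image_injective ((psi_inj (a := a) (d := c) (by omega)).prodMap
      (psi_inj (a := a) (d := c) (by omega))) i2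
    rw [i3, i4, i5]

lemma Trg_unique {N a b c a' b' c' q1 q2 : ℕ} {F : Finset (ℕ × ℕ)}
    (h : F ∈ Trg N a b c) (h' : F ∈ Trg N a' b' c')
    (ha : a < q1) (hb : q1 ≤ b) (hb2 : b < q2) (hc : q2 ≤ c)
    (ha' : a' < q1) (hb' : q1 ≤ b') (hb2' : b' < q2) (hc' : q2 ≤ c') :
    a = a' ∧ b = b' ∧ c = c' := by
  rw [mem_Trg] at h h'
  have hN := (mem_Tri.1 h.1).1
  have nc : ∀ {u v w z : ℕ}, E F u v → E F w z → ¬ Crs (u, v) (w, z) := by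
    intro u v w z h h'
    rcases h with h | h <;> rcases h' with h' | h'
    · exact hN.2 _ h _ h'
    · have := hN.1 _ h; simp only [Crs] at *; omega
    · have := hN.1 _ h'; simp only [Crs] at *; omega
    · simp only [Crs] at *; omega
  obtain ⟨-, h1, h2, h3⟩ := h
  obtain ⟨-, h1', h2', h3'⟩ := h'
  have n1 := nc h2 (Or.inl h1')
  have n2 := nc h2' (Or.inl h1)
  have n3 := nc h3 h2'
  have n4 := nc h3' h2
  have n5 := nc h3 (Or.inl h1')
  have n6 := nc h3' (Or.inl h1)
  simp only [Crs] at *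
  omega

def vv {n : ℕ} (p : Fin n × Fin n) : ℕ × ℕ := (p.1.val, p.2.val)

lemma vv_inj {n : ℕ} : Function.Injective (vv : Fin n × Fin n → ℕ × ℕ) := by
  rintro ⟨a, b⟩ ⟨c, d⟩ h
  simp only [vv, Prod.mk.injEq] at h
  exact Prod.ext (Fin.ext h.1) (Fin.ext h.2)

def aug {n : ℕ} (T : OPT n) : Finset (ℕ × ℕ) := insert (0, n - 1) (T.1.image vv)

lemma top_notMem {n : ℕ} (T : OPT n) : (0, n - 1) ∉ T.1.image vv := by
  intro h
  obtain ⟨p, hp, he⟩ := mem_image.1 h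
  have := T.2.1 p hp
  simp only [vv, Prod.mk.injEq] at he
  exact this.2.2 he

lemma aug_mem {n : ℕ} (hn : 4 ≤ n) (T : OPT n) : aug T ∈ Tri 0 (n - 1) := by
  obtain ⟨h1, h2, h3⟩ := T.2
  refine mem_Tri.2 ⟨⟨?_, ?_⟩, ?_⟩
  · intro p hp
    rcases mem_insert.1 hp with rfl | hp
    · simp only; omega
    · obtain ⟨q, hq, rfl⟩ := mem_image.1 hp
      have := h1 q hq
      have := q.2.isLt
      simp only [vv]; omega
  · intro p hp q hq
    rcases mem_insert.1 hp with rfl | hp <;> rcases mem_insert.1 hq with rfl | hq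
    · simp only [Crs]; omega
    · obtain ⟨q', hq', rfl⟩ := mem_image.1 hq
      have := q'.2.isLt
      simp only [Crs, vv]; omega
    · obtain ⟨q', hq', rfl⟩ := mem_image.1 hp
      have := q'.2.isLt
      simp only [Crs, vv]; omega
    · obtain ⟨p', hp', rfl⟩ := mem_image.1 hp
      obtain ⟨q', hq', rfl⟩ := mem_image.1 hq
      exact h2 p' hp' q' hq'
  · unfold aug
    rw [card_insert_of_notMem (top_notMem T), card_image_of_injective _ vv_inj, h3]
    omega

lemma aug_inj {n : ℕ} : Function.Injective (aug : OPT n → Finset (ℕ × ℕ)) := by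
  intro T T' h
  unfold aug at h
  have h2 : T.1.image vv = T'.1.image vv := by
    rw [← erase_insert (top_notMem T), ← erase_insert (top_notMem T'), h]
  exact Subtype.ext (image_injective vv_inj h2)

lemma aug_surj {n : ℕ} (hn : 4 ≤ n) {F : Finset (ℕ × ℕ)} (hF : F ∈ Tri 0 (n - 1)) :
    ∃ T : OPT n, aug T = F := by
  classical
  obtain ⟨hN, hc⟩ := mem_Tri.1 hF
  have htop := Tri_top hF (by omega)
  let T : Finset (Fin n × Fin n) := univ.filter (fun p => vv p ∈ F.erase (0, n - 1))
  have himg : T.image vv = F.erase (0, n - 1) := by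
    ext p
    simp only [T, mem_image, mem_filter, mem_univ, true_and]
    constructor
    · rintro ⟨q, hq, rfl⟩; exact hq
    · intro hp
      have := hN.1 _ (mem_of_mem_erase hp)
      exact ⟨(⟨p.1, by omega⟩, ⟨p.2, by omega⟩), hp, rfl⟩
  have hm : ∀ p ∈ T, vv p ∈ F ∧ vv p ≠ (0, n - 1) := by
    intro p hp
    have := (mem_filter.1 hp).2
    exact ⟨mem_of_mem_erase this, ne_of_mem_erase this⟩
  have hT : IsOPT n T := by
    refine ⟨?_, ?_, ?_⟩
    · intro p hp
      obtain ⟨h1, h2⟩ := hm p hp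
      have h3 := hN.1 _ h1
      simp only [vv, ne_eq, Prod.mk.injEq] at h2 h3
      rw [Fin.lt_def]
      omega
    · intro p hp q hq
      exact hN.2 _ (hm p hp).1 _ (hm q hq).1
    · rw [← card_image_of_injective T vv_inj, himg, card_erase_of_mem htop, hc]
      omega
  refine ⟨⟨T, hT⟩, ?_⟩
  unfold aug
  simp only
  rw [himg, insert_erase htop]

lemma aug_sdiff {n : ℕ} (T T' : OPT n) : aug T \ aug T' = (T.1 \ T'.1).image vv := by
  rw [image_sdiff _ _ vv_inj]
  unfold aug
  have := top_notMem T
  ext p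
  simp only [mem_sdiff, mem_insert]
  constructor
  · rintro ⟨h1, h2⟩
    push Not at h2
    rcases h1 with h1 | h1
    · exact (h2.1 h1).elim
    · exact ⟨h1, h2.2⟩
  · rintro ⟨h1, h2⟩
    refine ⟨Or.inr h1, ?_⟩
    rintro (h | h)
    · subst h; exact this h1
    · exact h2 h

instance finOPT (n : ℕ) : Finite (OPT n) :=
  inferInstanceAs (Finite {T : Finset (Fin n × Fin n) // IsOPT n T})

lemma exists_flipOPT {n : ℕ} (hn : 4 ≤ n) (T : OPT n) {p : Fin n × Fin n} (hp : p ∈ T.1) :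
    ∃ T' : OPT n, flipAdj T T' ∧ T.1 \ T'.1 = {p} := by
  have hne : vv p ≠ (0, n - 1) := by
    intro h
    apply top_notMem T
    rw [← h]
    exact mem_image_of_mem _ hp
  obtain ⟨F', hF', h1, h2⟩ := exists_flip (aug_mem hn T)
    (mem_insert_of_mem (mem_image_of_mem vv hp)) hne
  obtain ⟨T', rfl⟩ := aug_surj hn hF'
  rw [aug_sdiff] at h1 h2
  rw [card_image_of_injective _ vv_inj] at h2
  have h3 : T.1 \ T'.1 = {p} := by
    apply image_injective vv_inj
    rw [h1, image_singleton]
  refine ⟨T', ⟨?_, h2⟩, h3⟩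
  rw [h3, card_singleton]

lemma vol_lower {n : ℕ} (hn : 4 ≤ n) (X : Set (OPT n)) : (n - 3) * X.ncard ≤ volCount X := by
  classical
  choose f hf1 hf2 using fun (T : OPT n) (p : Fin n × Fin n) (hp : p ∈ T.1) =>
    exists_flipOPT hn T hp
  have hfin : X.Finite := Set.toFinite X
  let W := hfin.toFinset.sigma (fun T => T.1.attach)
  have hW : W.card = (n - 3) * X.ncard := by
    simp only [W, card_sigma, card_attach]
    rw [sum_congr rfl (fun T _ => T.2.2.2), sum_const, smul_eq_mul, mul_comm,
      Set.ncard_eq_toFinset_card X hfin]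
  rw [← hW, volCount, ← Set.ncard_coe_finset]
  refine Set.ncard_le_ncard_of_injOn (fun s => (s.1, f s.1 s.2.1 s.2.2)) ?_ ?_ (Set.toFinite _)
  · rintro ⟨T, p, hp⟩ hs
    simp only [W, coe_sigma, Set.mem_sigma_iff, mem_coe, Set.Finite.mem_toFinset] at hs
    exact ⟨hs.1, hf1 T p hp⟩
  · rintro ⟨T, p, hp⟩ hs ⟨T', p', hp'⟩ hs' h
    simp only [Prod.mk.injEq] at h
    obtain ⟨rfl, h⟩ := h
    have e1 := hf2 T p hp
    have e2 := hf2 T p' hp'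
    rw [h, e2] at e1
    have := singleton_injective e1
    subst this
    rfl

lemma ncard_lower {n : ℕ} (hn : 4 ≤ n) (X : Set (OPT n)) (W : Finset (Finset (ℕ × ℕ)))
    (hW : W ⊆ Tri 0 (n - 1)) (h : ∀ T : OPT n, aug T ∈ W → T ∈ X) : W.card ≤ X.ncard := by
  rw [← Set.ncard_image_of_injective X aug_inj, ← Set.ncard_coe_finset]
  refine Set.ncard_le_ncard ?_ (Set.toFinite _)
  intro F hF
  obtain ⟨T, rfl⟩ := aug_surj hn (hW hF)
  exact ⟨T, h T hF, rfl⟩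

lemma trg_lower {n q1 q2 : ℕ} (hn : 4 ≤ n) (X : Set (OPT n)) (A B C : Finset ℕ)
    (hA : ∀ a ∈ A, a < q1) (hB : ∀ b ∈ B, q1 ≤ b ∧ b < q2) (hC : ∀ c ∈ C, q2 ≤ c ∧ c ≤ n - 1)
    (h : ∀ T : OPT n, ∀ a ∈ A, ∀ c ∈ C, (a, c) ∈ aug T → T ∈ X) :
    ∑ t ∈ A ×ˢ B ×ˢ C, catalan (t.2.1 - t.1 - 1) * (catalan (t.2.2 - t.2.1 - 1) *
      catalan (n - 1 - (t.2.2 - t.1))) ≤ X.ncard := by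
  classical
  refine le_trans ?_ (ncard_lower hn X ((A ×ˢ B ×ˢ C).biUnion
    (fun t => Trg (n - 1) t.1 t.2.1 t.2.2)) ?_ ?_)
  · rw [card_biUnion]
    · refine sum_le_sum ?_
      rintro ⟨a, b, c⟩ ht
      simp only [mem_product] at ht
      have := hA a ht.1
      have := hB b ht.2.1
      have := hC c ht.2.2
      exact card_Trg (a := a) (b := b) (c := c) (by omega) (by omega) (by omega)
    · rintro ⟨a, b, c⟩ ht ⟨a', b', c'⟩ ht' hne
      rw [Function.onFun, disjoint_left]
      intro F hF hF'
      simp only [coe_product, Set.mem_prod, mem_coe] at ht ht'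
      have h1 := hA a ht.1
      have h2 := hB b ht.2.1
      have h3 := hC c ht.2.2
      have h1' := hA a' ht'.1
      have h2' := hB b' ht'.2.1
      have h3' := hC c' ht'.2.2
      obtain ⟨e1, e2, e3⟩ := Trg_unique hF hF' h1 h2.1 h2.2 h3.1 h1' h2'.1 h2'.2 h3'.1
      simp only at e1 e2 e3
      exact hne (by rw [e1, e2, e3])
  · intro F hF
    obtain ⟨t, -, ht⟩ := mem_biUnion.1 hF
    exact (mem_Trg.1 ht).1
  · intro T hT
    obtain ⟨⟨a, b, c⟩, ht, hF⟩ := mem_biUnion.1 hT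
    simp only [mem_product] at ht
    exact h T a ht.1 c ht.2.2 (mem_Trg.1 hF).2.1

/-- the cut: triangulations with a diagonal from the first to the third quarter arc -/
def SS (n : ℕ) : Set (OPT n) :=
  {T | ∃ a c, (a, c) ∈ aug T ∧ a < n / 4 ∧ 2 * (n / 4) ≤ c ∧ c < 3 * (n / 4)}

lemma SS_lower {n : ℕ} (hn : 4 ≤ n) :
    ∑ t ∈ range (n / 4) ×ˢ Ico (n / 4) (2 * (n / 4)) ×ˢ Ico (2 * (n / 4)) (3 * (n / 4)),
      catalan (t.2.1 - t.1 - 1) * (catalan (t.2.2 - t.2.1 - 1) *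
      catalan (n - 1 - (t.2.2 - t.1))) ≤ (SS n).ncard := by
  apply trg_lower (q1 := n / 4) (q2 := 2 * (n / 4)) hn
  · intro a ha; rw [mem_range] at ha; omega
  · intro a ha; rw [mem_Ico] at ha; omega
  · intro a ha; rw [mem_Ico] at ha; omega
  · intro T a ha c hc h
    rw [mem_range] at ha
    rw [mem_Ico] at hc
    exact ⟨a, c, h, ha, hc.1, hc.2⟩

lemma SSc_lower {n : ℕ} (hn : 4 ≤ n) :
    ∑ t ∈ Ico (n / 4) (2 * (n / 4)) ×ˢ Ico (2 * (n / 4)) (3 * (n / 4)) ×ˢ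
        Ico (3 * (n / 4)) (4 * (n / 4)),
      catalan (t.2.1 - t.1 - 1) * (catalan (t.2.2 - t.2.1 - 1) *
      catalan (n - 1 - (t.2.2 - t.1))) ≤ (SS n)ᶜ.ncard := by
  apply trg_lower (q1 := 2 * (n / 4)) (q2 := 3 * (n / 4)) hn
  · intro a ha; rw [mem_Ico] at ha; omega
  · intro a ha; rw [mem_Ico] at ha; omega
  · intro a ha; rw [mem_Ico] at ha; omega
  · intro T b hb d hd h
    rw [mem_Ico] at hb hd
    rintro ⟨a, c, h', h1, h2, h3⟩
    have := (mem_Tri.1 (aug_mem hn T)).1.2 _ h _ h'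
    simp only [Crs] at this
    omega

lemma cut_upper {n : ℕ} (hn : 4 ≤ n) :
    cutCount (SS n) ≤
    ∑ t ∈ range (n / 4) ×ˢ Ico (n / 4) (2 * (n / 4)) ×ˢ Ico (2 * (n / 4)) (3 * (n / 4)) ×ˢ
        Ico (3 * (n / 4)) n,
      catalan (t.2.1 - t.1 - 1) * (catalan (t.2.2.1 - t.2.1 - 1) *
      (catalan (t.2.2.2 - t.2.2.1 - 1) * catalan (n - 1 - (t.2.2.2 - t.1)))) := by
  classical
  set I := range (n / 4) ×ˢ Ico (n / 4) (2 * (n / 4)) ×ˢ Ico (2 * (n / 4)) (3 * (n / 4)) ×ˢ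
        Ico (3 * (n / 4)) n with hI
  let W : Finset (Finset (ℕ × ℕ) × Finset (ℕ × ℕ)) := I.biUnion (fun t =>
    (Quad (n - 1) t.1 t.2.1 t.2.2.1 t.2.2.2).image
      (fun F => (F, insert (t.2.1, t.2.2.2) (F.erase (t.1, t.2.2.1)))))
  have hW : W.card ≤ ∑ t ∈ I, catalan (t.2.1 - t.1 - 1) * (catalan (t.2.2.1 - t.2.1 - 1) *
      (catalan (t.2.2.2 - t.2.2.1 - 1) * catalan (n - 1 - (t.2.2.2 - t.1)))) := by
    refine card_biUnion_le.trans (sum_le_sum ?_)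
    rintro ⟨a, b, c, d⟩ ht
    simp only [hI, mem_product, mem_range, mem_Ico] at ht
    exact card_image_le.trans (card_Quad (a := a) (b := b) (c := c) (d := d) (by omega)
      (by omega) (by omega) (by omega))
  refine le_trans ?_ hW
  rw [cutCount, ← Set.ncard_coe_finset]
  refine Set.ncard_le_ncard_of_injOn (fun e => (aug e.1, aug e.2)) ?_ ?_ (Set.toFinite _)
  · rintro ⟨T, T'⟩ ⟨hT, hT', hadj⟩
    simp only at hT hT' hadj
    obtain ⟨a, c, hac, h1, h2, h3⟩ := hT
    have hm := aug_mem hn T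
    have hm' := aug_mem hn T'
    obtain ⟨b, d, hbd, i1, i2, i3, i4⟩ := hex (q1 := n / 4) (q2 := 2 * (n / 4)) (q3 := 3 * (n / 4))
      (by omega) (by omega) (by omega) (by omega) hm' (by
        intro x y hxy hx hy hy'
        exact hT' ⟨x, y, hxy, hx, hy, hy'⟩)
    have hac' : (a, c) ∉ aug T' := fun h => hT' ⟨a, c, h, h1, h2, h3⟩
    have hbd' : (b, d) ∉ aug T := by
      intro h
      have := (mem_Tri.1 hm).1.2 _ h _ hac
      simp only [Crs] at this
      omega
    have c1 : (aug T \ aug T').card = 1 := by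
      rw [aug_sdiff, card_image_of_injective _ vv_inj]; exact hadj.1
    have c2 : (aug T' \ aug T).card = 1 := by
      rw [aug_sdiff, card_image_of_injective _ vv_inj]; exact hadj.2
    have u1 : ∀ p, p ∈ aug T → p ∉ aug T' → p = (a, c) := fun p hp hp' =>
      card_le_one.1 c1.le p (mem_sdiff.2 ⟨hp, hp'⟩) _ (mem_sdiff.2 ⟨hac, hac'⟩)
    have u2 : ∀ p, p ∈ aug T' → p ∉ aug T → p = (b, d) := fun p hp hp' =>
      card_le_one.1 c2.le p (mem_sdiff.2 ⟨hp, hp'⟩) _ (mem_sdiff.2 ⟨hbd, hbd'⟩)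
    have hins : insert (b, d) ((aug T).erase (a, c)) = aug T' := by
      ext p
      rw [mem_insert, mem_erase]
      constructor
      · rintro (rfl | ⟨h, h'⟩)
        · exact hbd
        · by_contra hcon
          exact h (u1 p h' hcon)
      · intro hp
        by_cases hp' : p ∈ aug T
        · exact Or.inr ⟨fun h => hac' (h ▸ hp), hp'⟩
        · exact Or.inl (u2 p hp hp')
    simp only [W, mem_coe, mem_biUnion, mem_image]
    refine ⟨(a, b, c, d), ?_, aug T, ?_, ?_⟩
    · simp only [hI, mem_product, mem_range, mem_Ico]
      omega
    · simp only [Quad, mem_filter]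
      refine ⟨hm, hac, ?_⟩
      intro p hp hne
      have hp' : p ∈ aug T' := by
        by_contra hcon
        exact hne (u1 p hp hcon)
      exact (mem_Tri.1 hm').1.2 _ hbd _ hp'
    · simp only [hins]
  · rintro ⟨T, T'⟩ _ ⟨U, U'⟩ _ h
    simp only [Prod.mk.injEq] at h
    rw [aug_inj h.1, aug_inj h.2]

lemma sq_le_sq_imp {a b : ℝ} (h : a ^ 2 ≤ b ^ 2) (hb : 0 ≤ b) : a ≤ b := by
  by_contra hcon
  push Not at hcon
  nlinarith

noncomputable def gg (x : ℕ) : ℝ := 1 / ((x : ℝ) * √(x : ℝ))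

lemma gg_nonneg (x : ℕ) : 0 ≤ gg x := by unfold gg; positivity

lemma gg_anti {x y : ℕ} (hx : 1 ≤ x) (hxy : x ≤ y) : gg y ≤ gg x := by
  unfold gg
  have h0 : (0 : ℝ) < x := by exact_mod_cast hx
  have h1 : (x : ℝ) ≤ y := by exact_mod_cast hxy
  have h2 := Real.sqrt_pos.2 h0
  have h3 := Real.sqrt_le_sqrt h1
  gcongr

lemma cb_upper (m : ℕ) : (3 * m + 1) * (Nat.centralBinom m) ^ 2 ≤ 16 ^ m := by
  induction m with
  | zero => simp
  | succ m ih =>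
    have h := Nat.succ_mul_centralBinom_succ m
    have hp : 0 < (m + 1) ^ 2 * (3 * m + 1) := by positivity
    refine Nat.le_of_mul_le_mul_left ?_ hp
    calc (m + 1) ^ 2 * (3 * m + 1) * ((3 * (m + 1) + 1) * (Nat.centralBinom (m + 1)) ^ 2)
        = (3 * m + 1) * (3 * (m + 1) + 1) * ((m + 1) * Nat.centralBinom (m + 1)) ^ 2 := by ring
      _ = (3 * (m + 1) + 1) * (2 * (2 * m + 1)) ^ 2 * ((3 * m + 1) * Nat.centralBinom m ^ 2) := by
          rw [h]; ring
      _ ≤ (3 * (m + 1) + 1) * (2 * (2 * m + 1)) ^ 2 * 16 ^ m := by gcongr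
      _ ≤ ((m + 1) ^ 2 * (3 * m + 1) * 16) * 16 ^ m := by
          apply Nat.mul_le_mul_right
          nlinarith
      _ = _ := by ring

lemma cb_lower (m : ℕ) : 16 ^ (m + 1) ≤ 4 * (m + 1) * (Nat.centralBinom (m + 1)) ^ 2 := by
  induction m with
  | zero => simp [Nat.centralBinom]
  | succ m ih =>
    have h := Nat.succ_mul_centralBinom_succ (m + 1)
    have hp : 0 < (m + 1 + 1) * (m + 1) := by positivity
    refine Nat.le_of_mul_le_mul_left ?_ hp
    calc (m + 1 + 1) * (m + 1) * 16 ^ (m + 1 + 1)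
        = 16 * ((m + 1 + 1) * (m + 1)) * 16 ^ (m + 1) := by ring
      _ ≤ (2 * (2 * (m + 1) + 1)) ^ 2 * 16 ^ (m + 1) := by
          apply Nat.mul_le_mul_right
          nlinarith
      _ ≤ (2 * (2 * (m + 1) + 1)) ^ 2 * (4 * (m + 1) * (Nat.centralBinom (m + 1)) ^ 2) := by gcongr
      _ = 4 * (m + 1) * (2 * (2 * (m + 1) + 1) * Nat.centralBinom (m + 1)) ^ 2 := by ring
      _ = 4 * (m + 1) * ((m + 1 + 1) * Nat.centralBinom (m + 1 + 1)) ^ 2 := by rw [h]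
      _ = _ := by ring

lemma cb_lower' (m : ℕ) : 16 ^ m ≤ 4 * (m + 1) * (Nat.centralBinom m) ^ 2 := by
  cases m with
  | zero => simp
  | succ m =>
    refine (cb_lower m).trans ?_
    gcongr
    omega

lemma cat_cb (m : ℕ) : ((m : ℝ) + 1) * (catalan m : ℝ) = (Nat.centralBinom m : ℝ) := by
  exact_mod_cast succ_mul_catalan_eq_centralBinom m

lemma cat_upper (m : ℕ) : (catalan m : ℝ) ≤ 4 ^ m * gg (m + 1) := by
  have hs : (0 : ℝ) < √((m : ℝ) + 1) := Real.sqrt_pos.2 (by positivity)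
  have hsq : √((m : ℝ) + 1) ^ 2 = (m : ℝ) + 1 := Real.sq_sqrt (by positivity)
  unfold gg
  push_cast
  rw [mul_one_div, le_div_iff₀ (by positivity)]
  have h1 : (catalan m : ℝ) * (((m : ℝ) + 1) * √((m : ℝ) + 1)) =
      (Nat.centralBinom m : ℝ) * √((m : ℝ) + 1) := by rw [← cat_cb]; ring
  rw [h1]
  refine sq_le_sq_imp ?_ (by positivity)
  rw [mul_pow, hsq]
  have h2 : ((3 * m + 1 : ℕ) : ℝ) * (Nat.centralBinom m : ℝ) ^ 2 ≤ 16 ^ m := by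
    exact_mod_cast cb_upper m
  have h3 : ((4 : ℝ) ^ m) ^ 2 = 16 ^ m := by rw [← pow_mul, mul_comm, pow_mul]; norm_num
  rw [h3]
  push_cast at h2
  have : (0 : ℝ) ≤ m * (Nat.centralBinom m : ℝ) ^ 2 := by positivity
  nlinarith

lemma cat_lower (m : ℕ) : 4 ^ m / 2 * gg (m + 1) ≤ (catalan m : ℝ) := by
  have hs : (0 : ℝ) < √((m : ℝ) + 1) := Real.sqrt_pos.2 (by positivity)
  have hsq : √((m : ℝ) + 1) ^ 2 = (m : ℝ) + 1 := Real.sq_sqrt (by positivity)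
  unfold gg
  push_cast
  rw [mul_one_div, div_le_iff₀ (by positivity)]
  have h1 : (catalan m : ℝ) * (((m : ℝ) + 1) * √((m : ℝ) + 1)) =
      (Nat.centralBinom m : ℝ) * √((m : ℝ) + 1) := by rw [← cat_cb]; ring
  rw [h1]
  refine sq_le_sq_imp ?_ (by positivity)
  rw [mul_pow, hsq, div_pow]
  have h2 : (16 : ℝ) ^ m ≤ 4 * ((m : ℝ) + 1) * (Nat.centralBinom m : ℝ) ^ 2 := by
    exact_mod_cast cb_lower' m
  have h3 : ((4 : ℝ) ^ m) ^ 2 = 16 ^ m := by rw [← pow_mul, mul_comm, pow_mul]; norm_num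
  rw [h3]
  nlinarith

lemma gg_tele (x : ℕ) (hx : 1 ≤ x) :
    gg x ≤ 4 / √(x : ℝ) - 4 / √((x + 1 : ℕ) : ℝ) := by
  have hx' : (1 : ℝ) ≤ x := by exact_mod_cast hx
  have h0 : (0 : ℝ) < √(x : ℝ) := Real.sqrt_pos.2 (by linarith)
  have h1 : (0 : ℝ) < √((x : ℝ) + 1) := Real.sqrt_pos.2 (by linarith)
  have s0 : √(x : ℝ) ^ 2 = x := Real.sq_sqrt (by linarith)
  have s1 : √((x : ℝ) + 1) ^ 2 = x + 1 := Real.sq_sqrt (by linarith)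
  unfold gg
  push_cast
  set s := √(x : ℝ)
  set t := √((x : ℝ) + 1)
  have hst : s ≤ t := by
    apply sq_le_sq_imp _ h1.le
    rw [s0, s1]; linarith
  have ht : 2 * t ≤ 3 * s := by
    apply sq_le_sq_imp _ (by positivity)
    rw [mul_pow, mul_pow, s0, s1]; linarith
  rw [← s0, div_sub_div _ _ h0.ne' h1.ne', div_le_div_iff₀ (by positivity) (by positivity)]
  have h5 : (t - s) * (t + s) = 1 := by nlinarith
  have hd : 0 ≤ t - s := by linarith
  have key : t ≤ 4 * (t - s) * s ^ 2 := by
    have e : t + s ≤ 5 / 2 * s := by linarith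
    have e2 : 1 ≤ (t - s) * (5 / 2 * s) := by
      rw [← h5]; exact mul_le_mul_of_nonneg_left e hd
    nlinarith
  nlinarith

lemma sum_gg_inner (u l : ℕ) :
    ∑ v ∈ range l, gg (u + v + 1) ≤ 4 / √((u + 1 : ℕ) : ℝ) - 4 / √((u + l + 1 : ℕ) : ℝ) := by
  induction l with
  | zero => simp
  | succ l ih =>
    rw [sum_range_succ]
    have := gg_tele (u + l + 1) (by omega)
    rw [show u + (l + 1) + 1 = u + l + 1 + 1 by omega]
    linarith

lemma sum_inv_sqrt (k : ℕ) : ∑ u ∈ range k, 1 / √((u + 1 : ℕ) : ℝ) ≤ 2 * √(k : ℝ) := by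
  induction k with
  | zero => simp
  | succ k ih =>
    rw [sum_range_succ]
    have h1 : (0 : ℝ) < √((k + 1 : ℕ) : ℝ) := Real.sqrt_pos.2 (by positivity)
    have h0 : (0 : ℝ) ≤ √(k : ℝ) := Real.sqrt_nonneg _
    have s0 : √(k : ℝ) ^ 2 = k := Real.sq_sqrt (by positivity)
    have s1 : √((k + 1 : ℕ) : ℝ) ^ 2 = k + 1 := by rw [Real.sq_sqrt (by positivity)]; push_cast; ring
    set s := √(k : ℝ)
    set t := √((k + 1 : ℕ) : ℝ)
    have : 1 / t ≤ 2 * t - 2 * s := by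
      rw [div_le_iff₀ h1]
      nlinarith [sq_nonneg (t - s)]
    linarith

lemma double_sum (k l : ℕ) :
    ∑ u ∈ range k, ∑ v ∈ range l, gg (u + v + 1) ≤ 8 * √(k : ℝ) := by
  have h : ∀ u ∈ range k, ∑ v ∈ range l, gg (u + v + 1) ≤ 4 * (1 / √((u + 1 : ℕ) : ℝ)) := by
    intro u _
    have := sum_gg_inner u l
    have h2 : 0 ≤ 4 / √((u + l + 1 : ℕ) : ℝ) := by positivity
    rw [mul_one_div]
    linarith
  have h3 := sum_le_sum h
  rw [← mul_sum] at h3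
  have := sum_inv_sqrt k
  linarith

lemma arc_sum (s q e : ℕ) :
    ∑ a ∈ Ico s (s + q), ∑ b ∈ Ico (s + q) e, gg (b - a) ≤ 8 * √(q : ℝ) := by
  refine le_trans (le_of_eq ?_) (double_sum q (e - (s + q)))
  rw [sum_Ico_eq_sum_range, Nat.add_sub_cancel_left, ← sum_range_reflect]
  refine sum_congr rfl fun j hj => ?_
  rw [mem_range] at hj
  rw [sum_Ico_eq_sum_range]
  refine sum_congr rfl fun i hi => ?_
  congr 1
  omega

lemma wrap_sum (q e n : ℕ) :
    ∑ a ∈ range q, ∑ d ∈ Ico e n, gg (n - d + a) ≤ 8 * √(q : ℝ) := by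
  refine le_trans (le_of_eq ?_) (double_sum q (n - e))
  refine sum_congr rfl fun j hj => ?_
  rw [sum_Ico_eq_sum_range, ← sum_range_reflect]
  refine sum_congr rfl fun i hi => ?_
  rw [mem_range] at hi
  congr 1
  omega

lemma gg_pair {q y w : ℕ} (hq : 1 ≤ q) (hy : q ≤ 2 * y) (hw : q ≤ 2 * w) :
    gg y * gg w ≤ 8 / (q : ℝ) ^ 3 := by
  have hq' : (1 : ℝ) ≤ q := by exact_mod_cast hq
  have hy' : (q : ℝ) / 2 ≤ y := by
    have : (q : ℝ) ≤ 2 * y := by exact_mod_cast hy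
    linarith
  have hw' : (q : ℝ) / 2 ≤ w := by
    have : (q : ℝ) ≤ 2 * w := by exact_mod_cast hw
    linarith
  have key : ∀ z : ℝ, (q : ℝ) / 2 ≤ z → 1 / (z * √z) ≤ 1 / ((q / 2) * √((q : ℝ) / 2)) := by
    intro z hz
    have h0 : (0 : ℝ) < q / 2 := by linarith
    have := Real.sqrt_pos.2 h0
    have := Real.sqrt_le_sqrt hz
    have hz0 : 0 ≤ z := by linarith
    gcongr
  have h0 : (0 : ℝ) < q / 2 := by linarith
  have hs := Real.sqrt_pos.2 h0
  have hss : √((q : ℝ) / 2) * √((q : ℝ) / 2) = q / 2 := Real.mul_self_sqrt h0.le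
  calc gg y * gg w ≤ 1 / ((q / 2) * √((q : ℝ) / 2)) * (1 / ((q / 2) * √((q : ℝ) / 2))) := by
        apply mul_le_mul (key _ hy') (key _ hw') (gg_nonneg _) (by positivity)
    _ = 1 / ((q / 2) * (q / 2) * (√((q : ℝ) / 2) * √((q : ℝ) / 2))) := by
        rw [div_mul_div_comm]; congr 1 <;> ring
    _ = 8 / (q : ℝ) ^ 3 := by
        rw [hss]; field_simp; norm_num

lemma four_gg {q x y z w : ℕ} (hq : 1 ≤ q) (h1 : q ≤ x + y) (h2 : q ≤ y + z) (h3 : q ≤ z + w)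
    (h4 : q ≤ w + x) :
    gg x * (gg y * (gg z * gg w)) ≤ 8 / (q : ℝ) ^ 3 * (gg x * gg z + gg y * gg w) := by
  have hx := gg_nonneg x
  have hy := gg_nonneg y
  have hz := gg_nonneg z
  have hw := gg_nonneg w
  have hc : (0 : ℝ) ≤ 8 / (q : ℝ) ^ 3 := by positivity
  by_cases h : q ≤ 2 * y ∧ q ≤ 2 * w
  · have := mul_le_mul_of_nonneg_left (gg_pair hq h.1 h.2) (mul_nonneg hx hz)
    have h' := mul_nonneg hc (mul_nonneg hy hw)
    nlinarith
  · have := mul_le_mul_of_nonneg_left (gg_pair (y := x) (w := z) hq (by omega) (by omega))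
      (mul_nonneg hy hw)
    have h' := mul_nonneg hc (mul_nonneg hx hz)
    nlinarith

lemma cut_real {n : ℕ} (hn : 4 ≤ n) :
    (cutCount (SS n) : ℝ) ≤ 4 ^ (n - 4) * (1024 / ((n / 4 : ℕ) : ℝ) ^ 2) := by
  have h := cut_upper hn
  have h' : (cutCount (SS n) : ℝ) ≤ _ := Nat.cast_le.2 h
  refine h'.trans ?_
  clear h h'
  have hq : 1 ≤ n / 4 := by omega
  generalize hqq : n / 4 = q at *
  have hterm : ∀ t ∈ range q ×ˢ Ico q (2 * q) ×ˢ Ico (2 * q) (3 * q) ×ˢ Ico (3 * q) n,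
      (catalan (t.2.1 - t.1 - 1) : ℝ) * (catalan (t.2.2.1 - t.2.1 - 1) *
      (catalan (t.2.2.2 - t.2.2.1 - 1) * catalan (n - 1 - (t.2.2.2 - t.1)))) ≤
      4 ^ (n - 4) * (8 / (q : ℝ) ^ 3 * (gg (t.2.1 - t.1) * gg (t.2.2.2 - t.2.2.1) +
        gg (t.2.2.1 - t.2.1) * gg (n - t.2.2.2 + t.1))) := by
    rintro ⟨a, b, c, d⟩ ht
    simp only [mem_product, mem_range, mem_Ico] at ht ⊢
    have c1 := cat_upper (b - a - 1)
    have c2 := cat_upper (c - b - 1)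
    have c3 := cat_upper (d - c - 1)
    have c4 := cat_upper (n - 1 - (d - a))
    rw [show b - a - 1 + 1 = b - a by omega] at c1
    rw [show c - b - 1 + 1 = c - b by omega] at c2
    rw [show d - c - 1 + 1 = d - c by omega] at c3
    rw [show n - 1 - (d - a) + 1 = n - d + a by omega] at c4
    have hp : (4 : ℝ) ^ (n - 4) = 4 ^ (b - a - 1) * (4 ^ (c - b - 1) *
        (4 ^ (d - c - 1) * 4 ^ (n - 1 - (d - a)))) := by
      rw [← pow_add, ← pow_add, ← pow_add]; congr 1; omega
    have hfour := four_gg (q := q) (x := b - a) (y := c - b) (z := d - c) (w := n - d + a) hq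
      (by omega) (by omega) (by omega) (by omega)
    calc _ ≤ (4 ^ (b - a - 1) * gg (b - a)) * ((4 ^ (c - b - 1) * gg (c - b)) *
          ((4 ^ (d - c - 1) * gg (d - c)) * (4 ^ (n - 1 - (d - a)) * gg (n - d + a)))) := by
          have := gg_nonneg (b - a)
          have := gg_nonneg (c - b)
          have := gg_nonneg (d - c)
          have := gg_nonneg (n - d + a)
          gcongr
      _ = 4 ^ (n - 4) * (gg (b - a) * (gg (c - b) * (gg (d - c) * gg (n - d + a)))) := by
          rw [hp]; ring
      _ ≤ _ := by gcongr
  push_cast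
  refine (sum_le_sum hterm).trans ?_
  rw [← mul_sum]
  refine mul_le_mul_of_nonneg_left ?_ (by positivity)
  rw [← mul_sum, sum_add_distrib]
  have s1 : ∑ t ∈ range q ×ˢ Ico q (2 * q) ×ˢ Ico (2 * q) (3 * q) ×ˢ Ico (3 * q) n,
      gg (t.2.1 - t.1) * gg (t.2.2.2 - t.2.2.1) =
      (∑ a ∈ range q, ∑ b ∈ Ico q (2 * q), gg (b - a)) *
      (∑ c ∈ Ico (2 * q) (3 * q), ∑ d ∈ Ico (3 * q) n, gg (d - c)) := by
    simp only [sum_product, ← mul_sum, ← sum_mul]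
  have s2 : ∑ t ∈ range q ×ˢ Ico q (2 * q) ×ˢ Ico (2 * q) (3 * q) ×ˢ Ico (3 * q) n,
      gg (t.2.2.1 - t.2.1) * gg (n - t.2.2.2 + t.1) =
      (∑ b ∈ Ico q (2 * q), ∑ c ∈ Ico (2 * q) (3 * q), gg (c - b)) *
      (∑ a ∈ range q, ∑ d ∈ Ico (3 * q) n, gg (n - d + a)) := by
    simp only [sum_product, ← mul_sum, ← sum_mul]
  rw [s1, s2]
  have a1 := arc_sum 0 q (2 * q)
  have a2 := arc_sum (2 * q) q n
  have a3 := arc_sum q q (3 * q)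
  have a4 := wrap_sum q (3 * q) n
  rw [zero_add, ← range_eq_Ico] at a1
  rw [show 2 * q + q = 3 * q by ring] at a2
  rw [show q + q = 2 * q by ring] at a3
  have hs : √(q : ℝ) * √(q : ℝ) = q := Real.mul_self_sqrt (by positivity)
  have hq' : (0 : ℝ) < q := by exact_mod_cast hq
  have m1 := mul_le_mul a1 a2 (sum_nonneg fun _ _ => sum_nonneg fun _ _ => gg_nonneg _)
    (by positivity)
  have m2 := mul_le_mul a3 a4 (sum_nonneg fun _ _ => sum_nonneg fun _ _ => gg_nonneg _)
    (by positivity)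
  calc _ ≤ 8 / (q : ℝ) ^ 3 * (8 * √(q : ℝ) * (8 * √(q : ℝ)) + 8 * √(q : ℝ) * (8 * √(q : ℝ))) :=
        mul_le_mul_of_nonneg_left (add_le_add m1 m2) (by positivity)
    _ = 8 / (q : ℝ) ^ 3 * (128 * (√(q : ℝ) * √(q : ℝ))) := by ring
    _ = 1024 / (q : ℝ) ^ 2 := by rw [hs]; field_simp; norm_num

lemma low_sum {n q : ℕ} (hn : 4 ≤ n) (hq : n ≤ 8 * q) (A B C : Finset ℕ)
    (cA : A.card = q) (cB : B.card = q) (cC : C.card = q)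
    (h : ∀ a ∈ A, ∀ b ∈ B, ∀ c ∈ C, a < b ∧ b < c ∧ c < n) (X : ℕ)
    (hX : ∑ t ∈ A ×ˢ B ×ˢ C, catalan (t.2.1 - t.1 - 1) * (catalan (t.2.2 - t.2.1 - 1) *
      catalan (n - 1 - (t.2.2 - t.1))) ≤ X) :
    4 ^ (n - 3) / 4096 * gg n ≤ (X : ℝ) := by
  have h' : ((_ : ℕ) : ℝ) ≤ (X : ℝ) := Nat.cast_le.2 hX
  refine le_trans ?_ h'
  push_cast
  have hterm : ∀ t ∈ A ×ˢ B ×ˢ C, 4 ^ (n - 3) / 8 * gg n ^ 3 ≤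
      (catalan (t.2.1 - t.1 - 1) : ℝ) * (catalan (t.2.2 - t.2.1 - 1) *
      catalan (n - 1 - (t.2.2 - t.1))) := by
    rintro ⟨a, b, c⟩ ht
    simp only [mem_product] at ht ⊢
    have := h a ht.1 b ht.2.1 c ht.2.2
    have c1 := cat_lower (b - a - 1)
    have c2 := cat_lower (c - b - 1)
    have c3 := cat_lower (n - 1 - (c - a))
    have g1 : gg n ≤ gg (b - a - 1 + 1) := gg_anti (by omega) (by omega)
    have g2 : gg n ≤ gg (c - b - 1 + 1) := gg_anti (by omega) (by omega)
    have g3 : gg n ≤ gg (n - 1 - (c - a) + 1) := gg_anti (by omega) (by omega)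
    have g0 := gg_nonneg n
    have hp : (4 : ℝ) ^ (n - 3) = 4 ^ (b - a - 1) * (4 ^ (c - b - 1) * 4 ^ (n - 1 - (c - a))) := by
      rw [← pow_add, ← pow_add]; congr 1; omega
    have k1 : 4 ^ (b - a - 1) / 2 * gg n ≤ (catalan (b - a - 1) : ℝ) :=
      le_trans (by gcongr) c1
    have k2 : 4 ^ (c - b - 1) / 2 * gg n ≤ (catalan (c - b - 1) : ℝ) :=
      le_trans (by gcongr) c2
    have k3 : 4 ^ (n - 1 - (c - a)) / 2 * gg n ≤ (catalan (n - 1 - (c - a)) : ℝ) :=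
      le_trans (by gcongr) c3
    calc _ = (4 ^ (b - a - 1) / 2 * gg n) * ((4 ^ (c - b - 1) / 2 * gg n) *
          (4 ^ (n - 1 - (c - a)) / 2 * gg n)) := by rw [hp]; ring
      _ ≤ _ := by gcongr
  refine le_trans ?_ (card_nsmul_le_sum _ _ _ hterm)
  rw [card_product, card_product, cA, cB, cC, nsmul_eq_mul]
  push_cast
  have hq' : (n : ℝ) / 8 ≤ q := by
    have : (n : ℝ) ≤ 8 * q := by exact_mod_cast hq
    linarith
  have hn0 : (0 : ℝ) < n := by exact_mod_cast (by omega : 0 < n)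
  have hs : (0 : ℝ) < √(n : ℝ) := Real.sqrt_pos.2 hn0
  have hss : √(n : ℝ) ^ 2 = n := Real.sq_sqrt hn0.le
  have hgg : (n : ℝ) ^ 3 * gg n ^ 3 = gg n := by
    unfold gg
    rw [← hss]
    rw [Real.sqrt_sq hs.le]
    field_simp
  have h3 : ((n : ℝ) / 8) ^ 3 ≤ (q : ℝ) ^ 3 := by gcongr
  have g0 := gg_nonneg n
  calc 4 ^ (n - 3) / 4096 * gg n = (n / 8 : ℝ) ^ 3 * (4 ^ (n - 3) / 8 * gg n ^ 3) := by
        rw [← hgg]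
        rw [hgg]
        nth_rewrite 1 [← hgg]
        ring
    _ ≤ (q : ℝ) ^ 3 * (4 ^ (n - 3) / 8 * gg n ^ 3) := by gcongr
    _ = _ := by ring

lemma main {n : ℕ} (hn : 4 ≤ n) :
    (SS n).Nonempty ∧ SS n ≠ Set.univ ∧
        (cutCount (SS n) : ℝ) / min (Set.ncard (SS n) : ℝ) (Set.ncard (SS n)ᶜ : ℝ) ≤
          2 ^ 28 * (n : ℝ) ^ (-(1 / 2) : ℝ) ∧
        (cutCount (SS n) : ℝ) / min (volCount (SS n) : ℝ) (volCount (SS n)ᶜ : ℝ) ≤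
          2 ^ 28 * (n : ℝ) ^ (-(3 / 2) : ℝ) := by
  have hq8 : n ≤ 8 * (n / 4) := by omega
  have l1 := low_sum hn hq8 (range (n / 4)) (Ico (n / 4) (2 * (n / 4)))
    (Ico (2 * (n / 4)) (3 * (n / 4))) (by simp) (by rw [Nat.card_Ico]; omega)
    (by rw [Nat.card_Ico]; omega)
    (by intro a ha b hb c hc; simp only [mem_range, mem_Ico] at *; omega) _ (SS_lower hn)
  have l2 := low_sum hn hq8 (Ico (n / 4) (2 * (n / 4))) (Ico (2 * (n / 4)) (3 * (n / 4)))
    (Ico (3 * (n / 4)) (4 * (n / 4))) (by rw [Nat.card_Ico]; omega) (by rw [Nat.card_Ico]; omega)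
    (by rw [Nat.card_Ico]; omega)
    (by intro a ha b hb c hc; simp only [mem_Ico] at *; omega) _ (SSc_lower hn)
  have hn0 : (0 : ℝ) < n := by exact_mod_cast (by omega : 0 < n)
  have hs : (0 : ℝ) < √(n : ℝ) := Real.sqrt_pos.2 hn0
  have hss : √(n : ℝ) ^ 2 = n := Real.sq_sqrt hn0.le
  have hg : 0 < gg n := by unfold gg; positivity
  set L : ℝ := 4 ^ (n - 3) / 4096 * gg n with hL
  have hLpos : 0 < L := by positivity
  have hU : (cutCount (SS n) : ℝ) ≤ 4 ^ (n - 4) * (65536 / (n : ℝ) ^ 2) := by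
    refine (cut_real hn).trans ?_
    have hq' : (n : ℝ) / 8 ≤ ((n / 4 : ℕ) : ℝ) := by
      have : (n : ℝ) ≤ 8 * ((n / 4 : ℕ) : ℝ) := by exact_mod_cast hq8
      linarith
    refine mul_le_mul_of_nonneg_left ?_ (by positivity)
    calc 1024 / ((n / 4 : ℕ) : ℝ) ^ 2 ≤ 1024 / ((n : ℝ) / 8) ^ 2 := by gcongr
      _ = _ := by field_simp; norm_num
  have hp : (4 : ℝ) ^ (n - 3) = 4 * 4 ^ (n - 4) := by
    rw [← pow_succ']; congr 1; omega
  have hUL : (cutCount (SS n) : ℝ) ≤ (2 ^ 26 / √(n : ℝ)) * L := by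
    refine hU.trans (le_of_eq ?_)
    rw [hL, hp]
    unfold gg
    rw [← hss, Real.sqrt_sq hs.le]
    field_simp
    norm_num
  have r1 : (n : ℝ) ^ (-(1 / 2) : ℝ) = 1 / √(n : ℝ) := by
    rw [Real.rpow_neg hn0.le, ← Real.sqrt_eq_rpow, one_div]
  have r2 : (n : ℝ) ^ (-(3 / 2) : ℝ) = 1 / (n * √(n : ℝ)) := by
    rw [Real.rpow_neg hn0.le, show (3 / 2 : ℝ) = 1 + 1 / 2 by norm_num, Real.rpow_add hn0,
      Real.rpow_one, ← Real.sqrt_eq_rpow, one_div]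
  have v : ∀ X : Set (OPT n), L ≤ (X.ncard : ℝ) → (n : ℝ) / 4 * L ≤ (volCount X : ℝ) := by
    intro X hX
    have h1 : (((n - 3) * X.ncard : ℕ) : ℝ) ≤ (volCount X : ℝ) := Nat.cast_le.2 (vol_lower hn X)
    have h2 : (n : ℝ) / 4 ≤ ((n - 3 : ℕ) : ℝ) := by
      have : (n : ℝ) ≤ 4 * ((n - 3 : ℕ) : ℝ) := by exact_mod_cast (by omega : n ≤ 4 * (n - 3))
      linarith
    push_cast at h1
    refine le_trans ?_ h1
    gcongr
  refine ⟨?_, ?_, ?_, ?_⟩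
  · by_contra hne
    rw [Set.not_nonempty_iff_eq_empty] at hne
    rw [hne, Set.ncard_empty] at l1
    norm_num at l1
    linarith
  · intro hne
    rw [hne, Set.compl_univ, Set.ncard_empty] at l2
    norm_num at l2
    linarith
  · have hm : L ≤ min (Set.ncard (SS n) : ℝ) (Set.ncard (SS n)ᶜ : ℝ) := le_min l1 l2
    rw [div_le_iff₀ (hLpos.trans_le hm), r1]
    refine hUL.trans ?_
    refine mul_le_mul ?_ hm hLpos.le (by positivity)
    rw [mul_one_div]
    gcongr <;> norm_num
  · have hm : (n : ℝ) / 4 * L ≤ min (volCount (SS n) : ℝ) (volCount (SS n)ᶜ : ℝ) :=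
      le_min (v _ l1) (v _ l2)
    rw [div_le_iff₀ (lt_of_lt_of_le (by positivity) hm), r2]
    refine hUL.trans ?_
    refine le_trans (le_of_eq ?_) (mul_le_mul_of_nonneg_left hm (by positivity))
    field_simp
    norm_num

end FlipProof

theorem opt_flip_graph_cheeger_bound :
    ∃ K : ℝ, 0 < K ∧ ∀ n : ℕ, 4 ≤ n →
      ∃ S : Set (OPT n), S.Nonempty ∧ S ≠ Set.univ ∧
        (cutCount S : ℝ) / min (Set.ncard S : ℝ) (Set.ncard Sᶜ : ℝ) ≤
          K * (n : ℝ) ^ (-(1 / 2) : ℝ) ∧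
        (cutCount S : ℝ) / min (volCount S : ℝ) (volCount Sᶜ : ℝ) ≤
          K * (n : ℝ) ^ (-(3 / 2) : ℝ) := by
  exact ⟨2 ^ 28, by norm_num, fun n hn => ⟨FlipProof.SS n, FlipProof.main hn⟩⟩
end
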